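/- arXiv:1707.07417 — 3 statements merged into one kernel-verified Lean document; each statement's English description precedes it below -/
import Mathlib

section
/- Let X be a finite set of points in P^1 × P^{a_2} × ... × P^{a_n}, let X_1,...,X_t be its level sets with respect to η_1, let Y_i = π_1(X_i) ⊂ P^{a_2} × ... × P^{a_n} for each i, and let L_1,...,L_t ∈ k[x_{1,0}, x_{1,1}] be the linear forms defining the points {P_1,...,P_t} = η_1(X) ⊂ P^1. Assume X has the inclusion property with respect to π_1; in particular each Y_i is ACM and we may assume Y_1 ⊇ Y_2 ⊇ ... ⊇ Y_t. Then X is ACM, and moreover I_X = I_{Y_1} + L_1·I_{Y_2} + L_1 L_2·I_{Y_3} + ... + L_1 L_2 ⋯ L_{t-1}·I_{Y_t} + (L_1 L_2 ⋯ L_t). -/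
noncomputable section

/-- Points of projective `m`-space over the field `k`. -/
abbrev Pt (k : Type) [Field k] (m : ℕ) := Projectivization k (Fin (m + 1) → k)

set_option synthInstance.maxHeartbeats 1000000 in
/-- An ideal `I` of a polynomial ring defines an *arithmetically Cohen–Macaulay* (ACM)
quotient if there is a regular sequence on `R/I`, consisting of elements of the irrelevant
maximal ideal (generated by the images of the variables), whose length equals the Krull
dimension of `R/I`. -/
def IsACM {k : Type} [Field k] {σ : Type} (I : Ideal (MvPolynomial σ k)) : Prop :=
  ∃ rs : List (MvPolynomial σ k ⧸ I),
    (∀ r ∈ rs,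
      r ∈ Ideal.map (Ideal.Quotient.mk I)
            (Ideal.span (Set.range (MvPolynomial.X : σ → MvPolynomial σ k)))) ∧
    RingTheory.Sequence.IsRegular (MvPolynomial σ k ⧸ I) rs ∧
    (rs.length : WithBot ℕ∞) = ringKrullDim (MvPolynomial σ k ⧸ I)

variable (k : Type) [Field k]

/-- The multihomogeneous (saturated) vanishing ideal of a set of points of
`ℙ^{a 0} × ⋯ × ℙ^{a (m-1)}`: all polynomials vanishing on the multicone over the points. -/
def vanishPi {m : ℕ} {a : Fin m → ℕ} (Y : Set (∀ i, Pt k (a i))) :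
    Ideal (MvPolynomial ((i : Fin m) × Fin (a i + 1)) k) :=
  ⨅ (y : ∀ i, Pt k (a i)) (_ : y ∈ Y) (c : Fin m → k),
    RingHom.ker (MvPolynomial.eval
      (fun q : (i : Fin m) × Fin (a i + 1) => c q.1 * (y q.1).rep q.2))

/-- The multihomogeneous (saturated) vanishing ideal of a set of points of
`ℙ^1 × ℙ^{a 0} × ⋯ × ℙ^{a (m-1)}`. -/
def vanishP1Pi {m : ℕ} {a : Fin m → ℕ} (X : Set (Pt k 1 × ∀ i, Pt k (a i))) :
    Ideal (MvPolynomial (Fin 2 ⊕ (i : Fin m) × Fin (a i + 1)) k) :=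
  ⨅ (p : Pt k 1 × ∀ i, Pt k (a i)) (_ : p ∈ X) (s : k) (c : Fin m → k),
    RingHom.ker (MvPolynomial.eval
      (Sum.elim (s • p.1.rep)
        (fun q : (i : Fin m) × Fin (a i + 1) => c q.1 * ((p.2 q.1).rep q.2))))

section RegularSequenceModulo

variable {R : Type*} [CommRing R]

/-- `x` is a non-zero-divisor modulo the ideal `J`. -/
def RegularMod (J : Ideal R) (x : R) : Prop := ∀ a, x * a ∈ J → a ∈ J

/-- The list is a weakly regular sequence on the quotient by `J`. -/
def SeqRegularMod : Ideal R → List R → Prop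
  | _, [] => True
  | J, x :: xs => RegularMod J x ∧ SeqRegularMod (J ⊔ Ideal.span {x}) xs

theorem RegularMod.comap {S : Type*} [CommRing S] {f : R →+* S} (hf : Function.Surjective f)
    {J : Ideal S} {x : R} : RegularMod (J.comap f) x ↔ RegularMod J (f x) := by
  refine ⟨fun h a ha => ?_, fun h a ha => ?_⟩
  · obtain ⟨a, rfl⟩ := hf a
    exact h a (by simpa using ha)
  · exact h _ (by simpa using ha)

theorem comap_sup_span_singleton {S : Type*} [CommRing S] {f : R →+* S}
    (hf : Function.Surjective f) (J : Ideal S) (x : R) :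
    (J ⊔ Ideal.span {f x}).comap f = J.comap f ⊔ Ideal.span {x} := by
  have h : J ⊔ Ideal.span {f x} = (J.comap f ⊔ Ideal.span {x}).map f := by
    rw [Ideal.map_sup, Ideal.map_comap_of_surjective f hf, Ideal.map_span, Set.image_singleton]
  rw [h, Ideal.comap_map_of_surjective' f hf, sup_eq_left]
  exact le_sup_of_le_left (Ideal.ker_le_comap f)

theorem SeqRegularMod.comap {S : Type*} [CommRing S] {f : R →+* S} (hf : Function.Surjective f)
    {J : Ideal S} {rs : List R} :
    SeqRegularMod (J.comap f) rs ↔ SeqRegularMod J (rs.map f) := by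
  induction rs generalizing J with
  | nil => simp [SeqRegularMod]
  | cons x xs ih =>
    simp only [SeqRegularMod, List.map_cons, RegularMod.comap hf, ← ih,
      comap_sup_span_singleton hf]

theorem seqRegularMod_iff {J : Ideal R} {rs : List R} :
    SeqRegularMod J rs ↔
      ∀ i (h : i < rs.length), RegularMod (J ⊔ Ideal.ofList (rs.take i)) rs[i] := by
  induction rs generalizing J with
  | nil => simp [SeqRegularMod]
  | cons x xs ih =>
    simp only [SeqRegularMod, ih]
    refine ⟨fun h i hi => ?_, fun h => ⟨?_, fun i hi => ?_⟩⟩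
    · cases i with
      | zero => simpa using h.1
      | succ i => simpa [sup_assoc] using h.2 i (by simpa using hi)
    · have h0 := h 0 (by simp)
      rwa [List.take_zero, Ideal.ofList_nil, sup_bot_eq] at h0
    · have hi' := h (i + 1) (by simpa using hi)
      rwa [List.take_succ_cons, Ideal.ofList_cons, ← sup_assoc] at hi'

theorem isWeaklyRegular_iff_seqRegularMod {rs : List R} :
    RingTheory.Sequence.IsWeaklyRegular R rs ↔ SeqRegularMod ⊥ rs := by
  rw [RingTheory.Sequence.isWeaklyRegular_iff, seqRegularMod_iff]
  refine forall₂_congr fun i hi => ?_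
  rw [isSMulRegular_quotient_iff_mem_of_smul_mem]
  simp [RegularMod]

theorem isWeaklyRegular_quotient_iff {J : Ideal R} {rs : List R} :
    RingTheory.Sequence.IsWeaklyRegular (R ⧸ J) (rs.map (Ideal.Quotient.mk J)) ↔
      SeqRegularMod J rs := by
  rw [isWeaklyRegular_iff_seqRegularMod, ← SeqRegularMod.comap Ideal.Quotient.mk_surjective,
    ← RingHom.ker_eq_comap_bot, Ideal.mk_ker]

/-- `I` contains a weakly regular sequence of length `n` on the quotient by `J`. -/
def DepthGE (I : Ideal R) : ℕ → Ideal R → Prop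
  | 0, _ => True
  | n + 1, J => ∃ x ∈ I, RegularMod J x ∧ DepthGE I n (J ⊔ Ideal.span {x})

theorem SeqRegularMod.depthGE {I J : Ideal R} {rs : List R} (h : SeqRegularMod J rs)
    (hI : ∀ r ∈ rs, r ∈ I) : DepthGE I rs.length J := by
  induction rs generalizing J with
  | nil => trivial
  | cons x xs ih =>
    exact ⟨x, hI x (by simp), h.1, ih h.2 fun r hr => hI r (by simp [hr])⟩

/-- Simultaneous prime avoidance: if no nonzero class modulo any of finitely many ideals is killed
by `I`, then `I` contains a common non-zero-divisor. -/
theorem exists_regularMod_of_finite [IsNoetherianRing R] {ι : Type*} [Finite ι] (I : Ideal R)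
    (J : ι → Ideal R) (h : ∀ i a, (∀ x ∈ I, x * a ∈ J i) → a ∈ J i) :
    ∃ x ∈ I, ∀ i, RegularMod (J i) x := by
  by_contra! hc
  have hfin : (⋃ i, associatedPrimes R (R ⧸ J i)).Finite :=
    Set.finite_iUnion fun i => associatedPrimes.finite R (R ⧸ J i)
  have hsub : (I : Set R) ⊆ ⋃ p ∈ ⋃ i, associatedPrimes R (R ⧸ J i), (p : Set R) := by
    intro x hx
    obtain ⟨i, hi⟩ := hc x hx
    obtain ⟨a, hxa, ha⟩ : ∃ a, x * a ∈ J i ∧ a ∉ J i := by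
      simpa [RegularMod] using hi
    have hx' : x ∈ ⋃ p ∈ associatedPrimes R (R ⧸ J i), (p : Set R) := by
      rw [biUnion_associatedPrimes_eq_zero_divisors]
      refine ⟨Ideal.Quotient.mk _ a, by rwa [Ne, Ideal.Quotient.eq_zero_iff_mem], ?_⟩
      rw [Algebra.smul_def, Ideal.Quotient.algebraMap_eq, ← map_mul,
        Ideal.Quotient.eq_zero_iff_mem]
      exact hxa
    simp only [Set.mem_iUnion] at hx' ⊢
    obtain ⟨p, hp, hxp⟩ := hx'
    exact ⟨p, ⟨i, hp⟩, hxp⟩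
  obtain ⟨p, hp, hIp⟩ := (I.subset_union_prime_finite hfin (f := id) 0 0 fun p hp _ _ => by
    obtain ⟨i, hi⟩ := Set.mem_iUnion.1 hp
    exact hi.isPrime).1 hsub
  obtain ⟨i, hi⟩ := Set.mem_iUnion.1 hp
  have hprime := hi.isPrime
  rw [AssociatedPrimes.mem_iff, isAssociatedPrime_iff] at hi
  obtain ⟨-, b, hb⟩ := hi
  obtain ⟨a, rfl⟩ := Ideal.Quotient.mk_surjective b
  have hmem : ∀ x : R, x ∈ p ↔ x * a ∈ J i := by
    intro x
    rw [hb]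
    simp only [Submodule.mem_colon_singleton, Submodule.mem_bot]
    rw [Algebra.smul_def, Ideal.Quotient.algebraMap_eq, ← map_mul,
        Ideal.Quotient.eq_zero_iff_mem]
  have ha : a ∈ J i := h i a fun x hx => (hmem x).1 (hIp hx)
  exact hprime.ne_top ((Ideal.eq_top_iff_one _).2 ((hmem 1).2 (by simpa using ha)))

theorem RegularMod.mem_of_forall_mul_mem {I J : Ideal R} {x : R} (hx : x ∈ I)
    (h : RegularMod J x) (a : R) (ha : ∀ y ∈ I, y * a ∈ J) : a ∈ J :=
  h a (ha x hx)

theorem mem_sup_span_singleton {J : Ideal R} {x a : R} :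
    a ∈ J ⊔ Ideal.span {x} ↔ ∃ b, a - x * b ∈ J := by
  rw [sup_comm, Ideal.mem_span_singleton_sup]
  refine ⟨fun ⟨b, c, hc, h⟩ => ⟨b, ?_⟩, fun ⟨b, hb⟩ => ⟨b, _, hb, by ring⟩⟩
  rwa [← h, mul_comm, add_sub_cancel_left]

/-- Regular elements can be exchanged: `r, y` regular with `y` regular implies `y, r` regular. -/
theorem RegularMod.swap {J : Ideal R} {r y : R} (hr : RegularMod J r)
    (hy : RegularMod (J ⊔ Ideal.span {r}) y) : RegularMod (J ⊔ Ideal.span {y}) r := by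
  intro m hm
  obtain ⟨b, hb⟩ := mem_sup_span_singleton.1 hm
  have hb' : b ∈ J ⊔ Ideal.span {r} :=
    hy b (mem_sup_span_singleton.2 ⟨m, by rw [← neg_mem_iff]; convert hb using 1; ring⟩)
  obtain ⟨c, hc⟩ := mem_sup_span_singleton.1 hb'
  refine mem_sup_span_singleton.2 ⟨c, hr _ ?_⟩
  convert add_mem hb (J.mul_mem_left y hc) using 1
  ring

theorem DepthGE.sup_span_singleton [IsNoetherianRing R] {I : Ideal R} {n : ℕ} {J : Ideal R}
    (h : DepthGE I (n + 1) J) {x : R} (hxI : x ∈ I) (hx : RegularMod J x) :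
    DepthGE I n (J ⊔ Ideal.span {x}) := by
  induction n generalizing J x with
  | zero => trivial
  | succ n ih =>
    obtain ⟨r, hrI, hr, hd⟩ := h
    obtain ⟨s, hsI, hs, -⟩ := id hd
    have hxs : ∀ m, (∀ y ∈ I, y * m ∈ J ⊔ Ideal.span {x}) → m ∈ J ⊔ Ideal.span {x} := by
      intro m hm
      obtain ⟨b, hb⟩ := mem_sup_span_singleton.1 (hm r hrI)
      have hb' : b ∈ J ⊔ Ideal.span {r} := by
        refine hs.mem_of_forall_mul_mem hsI b fun y hy => ?_
        obtain ⟨c, hc⟩ := mem_sup_span_singleton.1 (hm y hy)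
        refine mem_sup_span_singleton.2 ⟨c, hx _ ?_⟩
        convert sub_mem (J.mul_mem_left r hc) (J.mul_mem_left y hb) using 1
        ring
      obtain ⟨c, hc⟩ := mem_sup_span_singleton.1 hb'
      refine mem_sup_span_singleton.2 ⟨c, hr _ ?_⟩
      convert add_mem hb (J.mul_mem_left x hc) using 1
      ring
    obtain ⟨y, hyI, hy⟩ := exists_regularMod_of_finite I
      ![J, J ⊔ Ideal.span {x}, J ⊔ Ideal.span {r}] (by
        intro i
        fin_cases i
        · exact hx.mem_of_forall_mul_mem hxI
        · exact hxs
        · exact hs.mem_of_forall_mul_mem hsI)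
    have hyx : RegularMod (J ⊔ Ideal.span {x}) y := hy 1
    have hyr : RegularMod (J ⊔ Ideal.span {r}) y := hy 2
    refine ⟨y, hyI, hyx, ?_⟩
    have h1 : DepthGE I n (J ⊔ Ideal.span {r} ⊔ Ideal.span {y}) := ih hd hyI hyr
    rw [sup_right_comm] at h1
    have h2 : DepthGE I (n + 1) (J ⊔ Ideal.span {y}) := ⟨r, hrI, hr.swap hyr, h1⟩
    have h3 := ih h2 hxI (hx.swap hyx)
    rwa [sup_right_comm] at h3

/-- Finitely many quotients of depth at least `n` admit a common regular sequence of length `n`. -/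
theorem exists_seqRegularMod_of_finite [IsNoetherianRing R] {ι : Type*} [Finite ι] {I : Ideal R}
    {n : ℕ} {J : ι → Ideal R} (h : ∀ i, DepthGE I n (J i)) :
    ∃ rs : List R, rs.length = n ∧ (∀ r ∈ rs, r ∈ I) ∧ ∀ i, SeqRegularMod (J i) rs := by
  induction n generalizing J with
  | zero => exact ⟨[], rfl, by simp, fun _ => trivial⟩
  | succ n ih =>
    obtain ⟨x, hxI, hx⟩ := exists_regularMod_of_finite I J fun i => by
      obtain ⟨s, hsI, hs, -⟩ := h i
      exact hs.mem_of_forall_mul_mem hsI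
    obtain ⟨rs, hlen, hrs, hreg⟩ := ih fun i => (h i).sup_span_singleton hxI (hx i)
    exact ⟨x :: rs, by simp [hlen], by simpa using ⟨hxI, hrs⟩, fun i => ⟨hx i, hreg i⟩⟩

end RegularSequenceModulo

section CoeffIdeal

open Polynomial

variable {A : Type*} [CommRing A]

/-- The ideal of polynomials whose `n`-th coefficient lies in `K n`, for an increasing sequence
of ideals `K`. -/
def coeffIdeal (K : ℕ → Ideal A) (hK : Monotone K) : Ideal A[X] where
  carrier := {p | ∀ n, p.coeff n ∈ K n}
  zero_mem' := by simp
  add_mem' hp hq n := by simpa using add_mem (hp n) (hq n)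
  smul_mem' q p hp n := by
    rw [smul_eq_mul, coeff_mul]
    refine sum_mem fun ij hij => Ideal.mul_mem_left _ _ (hK ?_ (hp ij.2))
    have := Finset.HasAntidiagonal.mem_antidiagonal.1 hij
    omega

theorem mem_coeffIdeal {K : ℕ → Ideal A} {hK : Monotone K} {p : A[X]} :
    p ∈ coeffIdeal K hK ↔ ∀ n, p.coeff n ∈ K n := Iff.rfl

theorem coeffIdeal_sup_span_C (K : ℕ → Ideal A) (hK : Monotone K) (f : A) :
    coeffIdeal K hK ⊔ Ideal.span {C f} =
      coeffIdeal (fun n => K n ⊔ Ideal.span {f}) fun _ _ h => sup_le_sup_right (hK h) _ := by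
  ext p
  rw [mem_sup_span_singleton]
  refine ⟨fun ⟨b, hb⟩ n => mem_sup_span_singleton.2 ⟨b.coeff n, ?_⟩, fun h => ?_⟩
  · simpa using hb n
  choose b hb using fun n => mem_sup_span_singleton.1 (h n)
  refine ⟨∑ n ∈ p.support, monomial n (b n), fun n => ?_⟩
  simp only [coeff_sub, coeff_C_mul, finsetSum_coeff, coeff_monomial, Finset.sum_ite_eq', mem_support_iff]
  split_ifs with h
  · exact hb n
  · simp [notMem_support_iff.1 h]

theorem SeqRegularMod.coeffIdeal {K : ℕ → Ideal A} (hK : Monotone K) {rs : List A}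
    (h : ∀ n, SeqRegularMod (K n) rs) : SeqRegularMod (coeffIdeal K hK) (rs.map C) := by
  induction rs generalizing K with
  | nil => trivial
  | cons x xs ih =>
    refine ⟨fun p hp n => (h n).1 _ ?_, ?_⟩
    · simpa using hp n
    · rw [coeffIdeal_sup_span_C]
      exact ih _ fun n => (h n).2

theorem seqRegularMod_top (rs : List A) : SeqRegularMod ⊤ rs := by
  induction rs with
  | nil => trivial
  | cons x xs ih => exact ⟨fun _ _ => trivial, by simpa using ih⟩

end CoeffIdeal

section ConeIdeal

open MvPolynomial

variable {k σ ι : Type} [Field k]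

/-- The prime ideal of the multicone over the multiprojective point with coordinates `v`, where
`π` sends a variable to the projective factor it belongs to. -/
def coneIdeal (π : σ → ι) (v : σ → k) : Ideal (MvPolynomial σ k) :=
  RingHom.ker (aeval fun q => X (π q) * C (v q) : MvPolynomial σ k →ₐ[k] MvPolynomial ι k)

instance coneIdeal_isPrime (π : σ → ι) (v : σ → k) : (coneIdeal π v).IsPrime :=
  RingHom.ker_isPrime _

theorem mem_coneIdeal [Infinite k] {π : σ → ι} {v : σ → k} {F : MvPolynomial σ k} :
    F ∈ coneIdeal π v ↔ ∀ c : ι → k, eval (fun q => c (π q) * v q) F = 0 := by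
  have key : ∀ c : ι → k, eval c (aeval (fun q => X (π q) * C (v q) : σ → MvPolynomial ι k) F) =
      eval (fun q => c (π q) * v q) F := by
    intro c
    induction F using MvPolynomial.induction_on with
    | C a => simp
    | add p q hp hq => simp only [map_add, hp, hq]
    | mul_X p i hp => simp only [map_mul, hp, aeval_X, eval_X, eval_C]
  rw [coneIdeal, RingHom.mem_ker]
  refine ⟨fun h c => ?_, fun h => MvPolynomial.funext fun c => ?_⟩
  · rw [← key, h, map_zero]
  · rw [key, h, map_zero]

theorem ringKrullDim_quotient_coneIdeal [Finite ι] {π : σ → ι} {v : σ → k}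
    (h : ∀ i, ∃ q, π q = i ∧ v q ≠ 0) :
    ringKrullDim (MvPolynomial σ k ⧸ coneIdeal π v) = Nat.card ι := by
  have hsurj : Function.Surjective
      (aeval fun q => X (π q) * C (v q) : MvPolynomial σ k →ₐ[k] MvPolynomial ι k) := by
    rw [← AlgHom.range_eq_top, eq_top_iff, ← MvPolynomial.adjoin_range_X, Algebra.adjoin_le_iff]
    rintro _ ⟨i, rfl⟩
    obtain ⟨q, rfl, hq⟩ := h i
    refine ⟨C (v q)⁻¹ * X q, ?_⟩
    rw [AlgHom.toRingHom_eq_coe, RingHom.coe_coe, map_mul, aeval_X, aeval_C,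
      algebraMap_eq, mul_left_comm, ← C_mul, inv_mul_cancel₀ hq, C_1, mul_one]
  rw [coneIdeal,
    ringKrullDim_eq_of_ringEquiv (Ideal.quotientKerAlgEquivOfSurjective hsurj).toRingEquiv,
    MvPolynomial.ringKrullDim_of_isNoetherianRing, ringKrullDim_eq_zero_of_field, zero_add]

theorem ringKrullDim_quotient_biInf {R T : Type*} [CommRing R] {Z : Set T} (hfin : Z.Finite)
    (hne : Z.Nonempty) (p : T → Ideal R) {d : WithBot ℕ∞}
    (hd : ∀ z ∈ Z, ringKrullDim (R ⧸ p z) = d) :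
    ringKrullDim (R ⧸ ⨅ z ∈ Z, p z) = d := by
  refine le_antisymm ?_ ?_
  · rw [ringKrullDim_quotient]
    refine iSup_le fun s => ?_
    obtain ⟨z, hz, hzs⟩ : ∃ z ∈ Z, p z ≤ s.head.1.asIdeal := by
      have h : ⨅ z ∈ Z, p z ≤ s.head.1.asIdeal := s.head.2
      lift Z to Finset T using hfin
      simp only [Finset.mem_coe] at h ⊢
      rw [← Finset.inf_eq_iInf] at h
      exact s.head.1.isPrime.inf_le'.1 h
    rw [← hd z hz, ringKrullDim_quotient]
    let s' : LTSeries (PrimeSpectrum.zeroLocus (p z : Set R)) :=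
      { length := s.length
        toFun := fun i => ⟨(s i).1, fun x hx => (s.monotone (Fin.zero_le i)) (hzs hx)⟩
        step := fun i => s.step i }
    exact le_iSup (fun s : LTSeries _ => (s.length : WithBot ℕ∞)) s'
  · obtain ⟨z, hz⟩ := hne
    rw [← hd z hz]
    exact ringKrullDim_le_of_surjective (Ideal.Quotient.factor (biInf_le p hz))
      (Ideal.Quotient.factor_surjective _)

theorem coneIdeal_le_span_X (π : σ → ι) (v : σ → k) :
    coneIdeal π v ≤ Ideal.span (Set.range X) := by
  intro F hF
  have h0 : constantCoeff F = 0 := by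
    have h := congrArg constantCoeff (RingHom.mem_ker.1 hF)
    rw [map_zero] at h
    rw [← h]
    clear h hF
    induction F using MvPolynomial.induction_on with
    | C a => simp
    | add p q hp hq => simp only [map_add, hp, hq]
    | mul_X p i hp => simp
  rw [← Set.image_univ, mem_ideal_span_X_image]
  intro m hm
  by_contra! hc
  have : m = 0 := by ext i; simpa using hc i
  subst this
  exact mem_support_iff.1 hm h0

theorem isACM_iff {I : Ideal (MvPolynomial σ k)} {n : ℕ} (hI : I ≤ Ideal.span (Set.range X))
    (hdim : ringKrullDim (MvPolynomial σ k ⧸ I) = n) :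
    IsACM I ↔ ∃ rs : List (MvPolynomial σ k), rs.length = n ∧
      (∀ r ∈ rs, r ∈ Ideal.span (Set.range X)) ∧ SeqRegularMod I rs := by
  have hcast : ∀ l : ℕ, ((l : WithBot ℕ∞) = (n : WithBot ℕ∞)) ↔ l = n := fun l => by
    norm_cast
  rw [IsACM, hdim]
  constructor
  · rintro ⟨rs, hrs, hreg, hlen⟩
    have hlift : ∃ rs' : List (MvPolynomial σ k), rs'.map (Ideal.Quotient.mk I) = rs ∧
        ∀ r ∈ rs', r ∈ Ideal.span (Set.range X) := by
      clear hreg hlen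
      induction rs with
      | nil => exact ⟨[], rfl, by simp⟩
      | cons x xs ih =>
        obtain ⟨xs', rfl, hxs'⟩ := ih fun r hr => hrs r (by simp [hr])
        obtain ⟨x', hx', rfl⟩ := (Ideal.mem_map_iff_of_surjective _
          Ideal.Quotient.mk_surjective).1 (hrs x (by simp))
        exact ⟨x' :: xs', rfl, by simpa using ⟨hx', hxs'⟩⟩
    obtain ⟨rs', rfl, hrs'⟩ := hlift
    exact ⟨rs', by simpa [hcast] using hlen, hrs',
      isWeaklyRegular_quotient_iff.1 hreg.toIsWeaklyRegular⟩
  · rintro ⟨rs, hlen, hrs, hreg⟩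
    have hmap : ∀ r ∈ rs.map (Ideal.Quotient.mk I),
        r ∈ Ideal.map (Ideal.Quotient.mk I) (Ideal.span (Set.range X)) := by
      intro r hr
      obtain ⟨r', hr', rfl⟩ := List.mem_map.1 hr
      exact Ideal.mem_map_of_mem _ (hrs r' hr')
    refine ⟨rs.map (Ideal.Quotient.mk I), hmap,
      ⟨isWeaklyRegular_quotient_iff.2 hreg, fun htop => ?_⟩, by simpa [hcast] using hlen⟩
    have h1 : (1 : MvPolynomial σ k ⧸ I) ∈
        Ideal.map (Ideal.Quotient.mk I) (Ideal.span (Set.range X)) := by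
      have h : (1 : MvPolynomial σ k ⧸ I) ∈
          Ideal.ofList (rs.map (Ideal.Quotient.mk I)) • (⊤ : Ideal (MvPolynomial σ k ⧸ I)) :=
        htop ▸ Submodule.mem_top
      rw [smul_eq_mul, Ideal.mul_top] at h
      exact Ideal.span_le.2 hmap h
    rw [← map_one (Ideal.Quotient.mk I), ← Ideal.mem_comap,
      Ideal.comap_map_of_surjective' _ Ideal.Quotient.mk_surjective, Ideal.mk_ker,
      sup_eq_left.2 hI, ← Set.image_univ, mem_ideal_span_X_image] at h1
    obtain ⟨i, -, hi⟩ := h1 0 (by simp)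
    exact hi rfl

end ConeIdeal

section LineRestriction

open MvPolynomial

variable {k σ ι : Type} [Field k]

theorem MvPolynomial.IsHomogeneous.exists_eq_linear {L : MvPolynomial (Fin 2) k}
    (hL : L.IsHomogeneous 1) : ∃ α β : k, L = C α * X 0 + C β * X 1 := by
  rw [← mem_homogeneousSubmodule, homogeneousSubmodule_one_eq_span_X,
    Submodule.mem_span_range_iff_exists_fun] at hL
  obtain ⟨c, rfl⟩ := hL
  exact ⟨c 0, c 1, by simp [smul_eq_C_mul]⟩

/-- Restriction to the line through `d` in the first two variables. -/
def lineHom (σ : Type) (d : Fin 2 → k) :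
    MvPolynomial (Fin 2 ⊕ σ) k →ₐ[k] Polynomial (MvPolynomial σ k) :=
  aeval (Sum.elim (fun i => Polynomial.C (C (d i)) * Polynomial.X) fun q => Polynomial.C (X q))

theorem lineHom_rename_inr (d : Fin 2 → k) (f : MvPolynomial σ k) :
    lineHom σ d (rename Sum.inr f) = Polynomial.C f := by
  induction f using MvPolynomial.induction_on with
  | C a => simp [lineHom, Polynomial.algebraMap_apply]
  | add p q hp hq => simp [hp, hq]
  | mul_X p i hp => simp [hp]; simp [lineHom]

theorem lineHom_rename_inl (d : Fin 2 → k) {L : MvPolynomial (Fin 2) k}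
    (hL : L.IsHomogeneous 1) :
    lineHom σ d (rename Sum.inl L) = Polynomial.C (C (eval d L)) * Polynomial.X := by
  obtain ⟨α, β, rfl⟩ := hL.exists_eq_linear
  simp [lineHom, Polynomial.algebraMap_apply]
  ring

theorem exists_dotProduct_fin_two_eq_one {d : Fin 2 → k} (hd : d ≠ 0) :
    ∃ w : Fin 2 → k, w 0 * d 0 + w 1 * d 1 = 1 := by
  obtain ⟨i, hi⟩ := Function.ne_iff.1 hd
  refine ⟨Pi.single i (d i)⁻¹, ?_⟩
  rw [Pi.zero_apply] at hi
  fin_cases i <;> simp_all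

theorem lineHom_surjective {d : Fin 2 → k} (hd : d ≠ 0) :
    Function.Surjective (lineHom σ d) := by
  obtain ⟨w, hw⟩ := exists_dotProduct_fin_two_eq_one hd
  have hX : lineHom σ d (rename Sum.inl (C (w 0) * X 0 + C (w 1) * X 1)) = Polynomial.X := by
    rw [lineHom_rename_inl]
    · simp [hw]
    · exact (isHomogeneous_C_mul_X _ _).add (isHomogeneous_C_mul_X _ _)
  intro p
  induction p using Polynomial.induction_on' with
  | add p q hp hq =>
    obtain ⟨F, rfl⟩ := hp
    obtain ⟨G, rfl⟩ := hq
    exact ⟨F + G, map_add _ _ _⟩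
  | monomial n a =>
    refine ⟨rename Sum.inr a * rename Sum.inl (C (w 0) * X 0 + C (w 1) * X 1) ^ n, ?_⟩
    rw [map_mul, map_pow, hX, lineHom_rename_inr, Polynomial.C_mul_X_pow_eq_monomial]

theorem ker_lineHom {d : Fin 2 → k} (hd : d ≠ 0) {L : MvPolynomial (Fin 2) k}
    (hL : L.IsHomogeneous 1) (hL0 : L ≠ 0) (hLd : eval d L = 0) :
    RingHom.ker (lineHom σ d) = Ideal.span {rename Sum.inl L} := by
  refine le_antisymm (fun F hF => ?_) ?_
  · obtain ⟨w, hw⟩ := exists_dotProduct_fin_two_eq_one hd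
    obtain ⟨α, β, rfl⟩ := hL.exists_eq_linear
    replace hLd : α * d 0 + β * d 1 = 0 := by simpa using hLd
    obtain ⟨l, hα, hβ⟩ : ∃ l : k, α = - l * d 1 ∧ β = l * d 0 :=
      ⟨β * w 0 - α * w 1, by linear_combination α * (-hw) + w 0 * hLd,
        by linear_combination (-β) * hw + w 1 * hLd⟩
    have hl : l ≠ 0 := by
      rintro rfl
      simp [hα, hβ] at hL0
    set z : MvPolynomial (Fin 2 ⊕ σ) k := rename Sum.inl (C (w 0) * X 0 + C (w 1) * X 1) with hz
    set I : Ideal (MvPolynomial (Fin 2 ⊕ σ) k) :=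
      Ideal.span {rename Sum.inl (C α * X 0 + C β * X 1)} with hI
    have hcomp : (Ideal.Quotient.mk I).comp ((Polynomial.eval₂RingHom
        (rename Sum.inr : MvPolynomial σ k →ₐ[k] MvPolynomial (Fin 2 ⊕ σ) k).toRingHom z).comp
          (lineHom σ d).toRingHom) = Ideal.Quotient.mk I := by
      refine MvPolynomial.ringHom_ext (fun a => ?_) fun q => ?_
      · simp [lineHom, Polynomial.algebraMap_apply]
      · rcases q with i | q
        · simp only [RingHom.comp_apply, AlgHom.toRingHom_eq_coe, RingHom.coe_coe, lineHom, aeval_X,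
            Sum.elim_inl, Polynomial.coe_eval₂RingHom, Polynomial.eval₂_mul, Polynomial.eval₂_C,
            Polynomial.eval₂_X, rename_C]
          rw [Ideal.Quotient.eq, hI, Ideal.mem_span_singleton']
          have hlC : C l * C l⁻¹ = (1 : MvPolynomial (Fin 2 ⊕ σ) k) := by
            rw [← C_mul, mul_inv_cancel₀ hl, C_1]
          have hwC : C (w 0) * C (d 0) + C (w 1) * C (d 1) =
              (1 : MvPolynomial (Fin 2 ⊕ σ) k) := by
            rw [← C_mul, ← C_mul, ← C_add, hw, C_1]
          fin_cases i
          · refine ⟨C (w 1) * C l⁻¹, ?_⟩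
            simp only [hz, hα, hβ, map_add, map_mul, rename_C, rename_X, map_neg, Fin.zero_eta]
            linear_combination (C (w 1) * (C (d 0) * X (Sum.inl 1) - C (d 1) * X (Sum.inl 0))) * hlC
              - X (Sum.inl 0) * hwC
          · refine ⟨-C (w 0) * C l⁻¹, ?_⟩
            simp only [hz, hα, hβ, map_add, map_mul, rename_C, rename_X, map_neg, Fin.mk_one]
            linear_combination (C (w 0) * (C (d 1) * X (Sum.inl 0) - C (d 0) * X (Sum.inl 1))) * hlC
              - X (Sum.inl 1) * hwC
        · simp [lineHom]
    have h := congrArg (fun f => f F) hcomp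
    simp only [RingHom.comp_apply] at h
    have hF' : (lineHom σ d).toRingHom F = 0 := hF
    rw [hF', map_zero, map_zero] at h
    exact Ideal.Quotient.eq_zero_iff_mem.1 h.symm
  · rw [Ideal.span_singleton_le_iff_mem, RingHom.mem_ker]
    rw [lineHom_rename_inl d hL, hLd]
    simp

theorem coeff_lineHom_mem_coneIdeal [Infinite k] {π : σ → ι} {v : σ → k} {d : Fin 2 → k}
    {F : MvPolynomial (Fin 2 ⊕ σ) k}
    (hF : F ∈ coneIdeal (Sum.map (fun _ : Fin 2 => ()) π) (Sum.elim d v)) (n : ℕ) :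
    (lineHom σ d F).coeff n ∈ coneIdeal π v := by
  rw [mem_coneIdeal] at hF ⊢
  intro c
  have key : ∀ s : k, Polynomial.eval s (Polynomial.map (eval fun q => c (π q) * v q)
      (lineHom σ d F)) = eval (fun q => Sum.elim (fun _ : Unit => s) c
        (Sum.map (fun _ : Fin 2 => ()) π q) * Sum.elim d v q) F := by
    intro s
    clear hF
    induction F using MvPolynomial.induction_on with
    | C a => simp [lineHom, Polynomial.algebraMap_apply]
    | add p q hp hq => simp [hp, hq]
    | mul_X p i hp =>
      simp only [map_mul, Polynomial.map_mul, Polynomial.eval_mul, hp]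
      congr 1
      rcases i with i | i
      · simp [lineHom, mul_comm s]
      · simp [lineHom]
  have h0 : Polynomial.map (eval fun q => c (π q) * v q) (lineHom σ d F) = 0 :=
    Polynomial.funext fun s => by rw [key, hF, Polynomial.eval_zero]
  rw [← Polynomial.coeff_map, h0, Polynomial.coeff_zero]

theorem rename_inl_mem_coneIdeal_iff {π : σ → ι} {v : σ → k} {d : Fin 2 → k}
    {L : MvPolynomial (Fin 2) k} (hL : L.IsHomogeneous 1) :
    rename Sum.inl L ∈ coneIdeal (Sum.map (fun _ : Fin 2 => ()) π) (Sum.elim d v) ↔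
      eval d L = 0 := by
  obtain ⟨α, β, rfl⟩ := hL.exists_eq_linear
  have h : aeval (fun q => X (Sum.map (fun _ : Fin 2 => ()) π q) * C (Sum.elim d v q) :
      Fin 2 ⊕ σ → MvPolynomial (Unit ⊕ ι) k) (rename Sum.inl (C α * X 0 + C β * X 1)) =
      C (eval d (C α * X 0 + C β * X 1)) * X (Sum.inl ()) := by
    simp [algebraMap_eq]
    ring
  rw [coneIdeal, RingHom.mem_ker, h, mul_eq_zero, or_iff_left (X_ne_zero _), C_eq_zero]

theorem rename_inr_mem_coneIdeal [Infinite k] {π : σ → ι} {v : σ → k} {d : Fin 2 → k}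
    {g : MvPolynomial σ k} (hg : g ∈ coneIdeal π v) :
    rename Sum.inr g ∈ coneIdeal (Sum.map (fun _ : Fin 2 => ()) π) (Sum.elim d v) := by
  rw [mem_coneIdeal] at hg ⊢
  intro c
  rw [eval_rename]
  exact hg fun i => c (Sum.inr i)

end LineRestriction

section LevelSets

open MvPolynomial

variable {k σ ι T : Type} [Field k]

/-- The product of the first `r` members of a finite family. -/
def initialProd {t : ℕ} {M : Type*} [CommMonoid M] (L : Fin t → M) (r : ℕ) : M :=
  ∏ i ∈ Finset.univ.filter (fun i : Fin t => (i : ℕ) < r), L i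

theorem initialProd_zero {t : ℕ} {M : Type*} [CommMonoid M] (L : Fin t → M) :
    initialProd L 0 = 1 := by
  simp [initialProd]

theorem initialProd_length {t : ℕ} {M : Type*} [CommMonoid M] (L : Fin t → M) :
    initialProd L t = ∏ i, L i := by
  simp [initialProd]

theorem initialProd_succ {t : ℕ} {M : Type*} [CommMonoid M] (L : Fin t → M) (r : Fin t) :
    initialProd L (r + 1) = initialProd L r * L r := by
  have h : Finset.univ.filter (fun i : Fin t => (i : ℕ) < r + 1) =
      insert r (Finset.univ.filter fun i : Fin t => (i : ℕ) < r) := by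
    ext i
    simp [Fin.ext_iff]
    omega
  rw [initialProd, initialProd, h, Finset.prod_insert (by simp), mul_comm]

/-- The ideal `∑ⱼ L₁⋯Lⱼ₋₁ · Iⱼ + (L₁⋯Lₜ)`. -/
def staircaseIdeal {t : ℕ} (L : Fin t → MvPolynomial (Fin 2) k)
    (I : Fin t → Ideal (MvPolynomial σ k)) : Ideal (MvPolynomial (Fin 2 ⊕ σ) k) :=
  (∑ j : Fin t, Ideal.span {rename Sum.inl (initialProd L j)} *
    Ideal.map (rename (Sum.inr : σ → Fin 2 ⊕ σ)) (I j)) +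
    Ideal.span {rename Sum.inl (initialProd L t)}

theorem mul_mem_staircaseIdeal {t : ℕ} {L : Fin t → MvPolynomial (Fin 2) k}
    {I : Fin t → Ideal (MvPolynomial σ k)} (j : Fin t) {g : MvPolynomial (Fin 2 ⊕ σ) k}
    (hg : g ∈ Ideal.map (rename (Sum.inr : σ → Fin 2 ⊕ σ)) (I j)) :
    rename Sum.inl (initialProd L j) * g ∈ staircaseIdeal L I := by
  refine Ideal.mem_sup_left ?_
  rw [Ideal.sum_eq_sup]
  have hle := Finset.le_sup (f := fun j : Fin t => Ideal.span {rename Sum.inl (initialProd L j)} *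
    Ideal.map (rename (Sum.inr : σ → Fin 2 ⊕ σ)) (I j)) (Finset.mem_univ j)
  exact hle (Ideal.mul_mem_mul (Ideal.mem_span_singleton_self _) hg)

theorem initialProd_mem_staircaseIdeal {t : ℕ} (L : Fin t → MvPolynomial (Fin 2) k)
    (I : Fin t → Ideal (MvPolynomial σ k)) :
    rename Sum.inl (initialProd L t) ∈ staircaseIdeal L I :=
  Ideal.mem_sup_right (Ideal.mem_span_singleton_self _)

theorem staircaseIdeal_le {t : ℕ} {L : Fin t → MvPolynomial (Fin 2) k}
    {I : Fin t → Ideal (MvPolynomial σ k)} {J : Ideal (MvPolynomial (Fin 2 ⊕ σ) k)}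
    (h : ∀ j, ∀ g ∈ I j, rename Sum.inl (initialProd L j) * rename Sum.inr g ∈ J)
    (ht : rename Sum.inl (initialProd L t) ∈ J) : staircaseIdeal L I ≤ J := by
  refine sup_le ?_ ((Ideal.span_singleton_le_iff_mem _).2 ht)
  rw [Ideal.sum_eq_sup]
  refine Finset.sup_le fun j _ => ?_
  rw [Ideal.map, Ideal.span_mul_span', Ideal.span_le]
  rintro _ ⟨_, rfl, _, ⟨g, hg, rfl⟩, rfl⟩
  exact h j g hg

/-- The ideal of the union of the level sets `{p j} × Y j`. -/
def levelIdeal {t : ℕ} (π : σ → ι) (v : T → σ → k) (p : Fin t → Fin 2 → k) (Y : Fin t → Set T) :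
    Ideal (MvPolynomial (Fin 2 ⊕ σ) k) :=
  ⨅ j, ⨅ y ∈ Y j, coneIdeal (Sum.map (fun _ : Fin 2 => ()) π) (Sum.elim (p j) (v y))

theorem mem_levelIdeal {t : ℕ} {π : σ → ι} {v : T → σ → k} {p : Fin t → Fin 2 → k}
    {Y : Fin t → Set T} {F : MvPolynomial (Fin 2 ⊕ σ) k} :
    F ∈ levelIdeal π v p Y ↔ ∀ j, ∀ y ∈ Y j,
      F ∈ coneIdeal (Sum.map (fun _ : Fin 2 => ()) π) (Sum.elim (p j) (v y)) := by
  simp [levelIdeal, Submodule.mem_iInf]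

theorem eval_eq_zero_iff_proportional {L : MvPolynomial (Fin 2) k} (hL : L.IsHomogeneous 1) (hL0 : L ≠ 0)
    {p d : Fin 2 → k} (hp : p ≠ 0) (hLp : eval p L = 0) :
    eval d L = 0 ↔ p 1 * d 0 = p 0 * d 1 := by
  obtain ⟨α, β, rfl⟩ := hL.exists_eq_linear
  obtain ⟨w, hw⟩ := exists_dotProduct_fin_two_eq_one hp
  simp only [map_add, map_mul, eval_C, eval_X] at hLp ⊢
  have hα : α = (α * w 1 - β * w 0) * p 1 := by linear_combination α * (-hw) + w 0 * hLp
  have hβ : β = -(α * w 1 - β * w 0) * p 0 := by linear_combination (-β) * hw + w 1 * hLp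
  set l := α * w 1 - β * w 0
  have hl : l ≠ 0 := by
    intro h
    rw [h] at hα hβ
    simp [hα, hβ] at hL0
  rw [hα, hβ]
  constructor
  · intro h
    refine mul_left_cancel₀ hl ?_
    linear_combination h
  · intro h
    linear_combination l * h

theorem levelIdeal_eq_staircaseIdeal [Infinite k] {t : ℕ} {π : σ → ι} {v : T → σ → k}
    {p : Fin t → Fin 2 → k} {Y : Fin t → Set T} (hY : Antitone Y)
    {L : Fin t → MvPolynomial (Fin 2) k} (hL : ∀ j, (L j).IsHomogeneous 1)
    (hL0 : ∀ j, L j ≠ 0) (hp : ∀ j, p j ≠ 0) (hLp : ∀ i j, eval (p i) (L j) = 0 ↔ i = j) :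
    levelIdeal π v p Y = staircaseIdeal L fun j => ⨅ y ∈ Y j, coneIdeal π (v y) := by
  refine le_antisymm (fun F hF => ?_) (staircaseIdeal_le (fun j g hg => ?_) ?_)
  · have key : ∀ n r (F : MvPolynomial (Fin 2 ⊕ σ) k), n + r = t → (∀ j : Fin t, r ≤ j → ∀ y ∈ Y j,
        F ∈ coneIdeal (Sum.map (fun _ : Fin 2 => ()) π) (Sum.elim (p j) (v y))) →
        rename Sum.inl (initialProd L r) * F ∈
          staircaseIdeal L fun j => ⨅ y ∈ Y j, coneIdeal π (v y) := by
      intro n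
      induction n with
      | zero =>
        intro r F hr _
        obtain rfl : r = t := by omega
        exact Ideal.mul_mem_right _ _ (initialProd_mem_staircaseIdeal _ _)
      | succ n ih =>
        intro r F hr hF
        obtain ⟨j, rfl⟩ : ∃ j : Fin t, (j : ℕ) = r := ⟨⟨r, by omega⟩, rfl⟩
        have hdecomp : F ∈ Ideal.map (rename (Sum.inr : σ → Fin 2 ⊕ σ))
            (⨅ y ∈ Y j, coneIdeal π (v y)) ⊔ Ideal.span {rename Sum.inl (L j)} := by
          rw [← ker_lineHom (hp j) (hL j) (hL0 j) ((hLp j j).2 rfl)]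
          have hsurj : Function.Surjective (lineHom σ (p j)).toRingHom := lineHom_surjective (hp j)
          have hcm := Ideal.comap_map_of_surjective' (lineHom σ (p j)).toRingHom hsurj
            (Ideal.map (rename (Sum.inr : σ → Fin 2 ⊕ σ)) (⨅ y ∈ Y j, coneIdeal π (v y)))
          refine hcm.le ?_
          have hcomp : (lineHom σ (p j)).toRingHom.comp
              (rename (Sum.inr : σ → Fin 2 ⊕ σ) : MvPolynomial σ k →ₐ[k] _).toRingHom =
              Polynomial.C := RingHom.ext fun f => lineHom_rename_inr _ _
          have hmap := Ideal.map_map (I := ⨅ y ∈ Y j, coneIdeal π (v y))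
            (rename (Sum.inr : σ → Fin 2 ⊕ σ) : MvPolynomial σ k →ₐ[k] _).toRingHom
            (lineHom σ (p j)).toRingHom
          rw [hcomp] at hmap
          refine hmap.symm.le ?_
          rw [Ideal.mem_map_C_iff]
          intro n
          simp only [Submodule.mem_iInf]
          exact fun y hy => coeff_lineHom_mem_coneIdeal (hF j le_rfl y hy) n
        obtain ⟨g, hg, l, hl, rfl⟩ := Submodule.mem_sup.1 hdecomp
        obtain ⟨G, rfl⟩ := Ideal.mem_span_singleton.1 hl
        rw [mul_add]
        refine add_mem (mul_mem_staircaseIdeal j hg) ?_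
        rw [← mul_assoc, ← map_mul, ← initialProd_succ]
        refine ih _ G (by omega) fun i hi y hy => ?_
        have hij : i ≠ j := by rintro rfl; omega
        have hyj : y ∈ Y j := hY (Fin.le_def.2 (by omega)) hy
        have hgi : g ∈ coneIdeal (Sum.map (fun _ : Fin 2 => ()) π) (Sum.elim (p i) (v y)) := by
          refine (Ideal.map_le_iff_le_comap (f := rename (Sum.inr : σ → Fin 2 ⊕ σ))).2 ?_ hg
          exact fun f hf => rename_inr_mem_coneIdeal (biInf_le (fun y => coneIdeal π (v y)) hyj hf)
        have hmul := (Ideal.add_mem_iff_right _ hgi).1 (hF i (by omega) y hy)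
        refine ((coneIdeal_isPrime _ _).mem_or_mem hmul).resolve_left ?_
        rwa [rename_inl_mem_coneIdeal_iff (hL j), hLp]
    have h := key t 0 F rfl fun j _ => mem_levelIdeal.1 hF j
    rwa [initialProd_zero, map_one, one_mul] at h
  all_goals
    refine mem_levelIdeal.2 fun i y hy => ?_
    have hdvd : ∀ r : ℕ, (i : ℕ) < r → rename Sum.inl (initialProd L r) ∈
        coneIdeal (Sum.map (fun _ : Fin 2 => ()) π) (Sum.elim (p i) (v y)) := fun r hr =>
      Ideal.mem_of_dvd _ (map_dvd _ (Finset.dvd_prod_of_mem L (by simpa using hr)))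
        ((rename_inl_mem_coneIdeal_iff (hL i)).2 ((hLp i i).2 rfl))
  · by_cases hij : i < j
    · exact Ideal.mul_mem_right _ _ (hdvd _ hij)
    · exact Ideal.mul_mem_left _ _ (rename_inr_mem_coneIdeal
        (biInf_le (fun y => coneIdeal π (v y)) (hY (not_lt.1 hij) hy) hg))
  · exact hdvd t i.2

theorem lineHom_initialProd {t : ℕ} {L : Fin t → MvPolynomial (Fin 2) k}
    (hL : ∀ j, (L j).IsHomogeneous 1) {d : Fin 2 → k} (hd : ∀ j, eval d (L j) ≠ 0) {r : ℕ}
    (hr : r ≤ t) : ∃ u : k, u ≠ 0 ∧ lineHom σ d (rename Sum.inl (initialProd L r)) =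
      Polynomial.C (C u) * Polynomial.X ^ r := by
  induction r with
  | zero => exact ⟨1, one_ne_zero, by simp [initialProd_zero]⟩
  | succ r ih =>
    obtain ⟨u, hu, h⟩ := ih (by omega)
    refine ⟨u * eval d (L ⟨r, hr⟩), mul_ne_zero hu (hd _), ?_⟩
    have hs := initialProd_succ L ⟨r, hr⟩
    simp only at hs
    rw [hs, map_mul, map_mul, h, lineHom_rename_inl d (hL _), C_mul, Polynomial.C_mul]
    ring

/-- A finite family of ideals, continued by the unit ideal. -/
def extendByTop {R : Type*} [CommRing R] {t : ℕ} (I : Fin t → Ideal R) (n : ℕ) : Ideal R :=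
  if h : n < t then I ⟨n, h⟩ else ⊤

theorem extendByTop_monotone {R : Type*} [CommRing R] {t : ℕ} {I : Fin t → Ideal R}
    (hI : Monotone I) : Monotone (extendByTop I) := by
  intro a b hab
  unfold extendByTop
  split_ifs with h1 h2 h2
  · exact hI (Fin.mk_le_mk.2 hab)
  · exact le_top
  · omega
  · exact le_rfl

theorem staircaseIdeal_sup_span {t : ℕ} {L : Fin t → MvPolynomial (Fin 2) k}
    (hL : ∀ j, (L j).IsHomogeneous 1) {d : Fin 2 → k} (hd0 : d ≠ 0) (hd : ∀ j, eval d (L j) ≠ 0)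
    {l : MvPolynomial (Fin 2) k} (hl : l.IsHomogeneous 1) (hl0 : l ≠ 0) (hld : eval d l = 0)
    {I : Fin t → Ideal (MvPolynomial σ k)} (hI : Monotone I) :
    staircaseIdeal L I ⊔ Ideal.span {rename Sum.inl l} =
      (coeffIdeal (extendByTop I) (extendByTop_monotone hI)).comap (lineHom σ d).toRingHom := by
  have hsurj : Function.Surjective (lineHom σ d).toRingHom := lineHom_surjective hd0
  have hunit : ∀ u : k, u ≠ 0 → Polynomial.C (C u⁻¹) * Polynomial.C (C u) =
      (1 : Polynomial (MvPolynomial σ k)) := fun u hu => by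
    rw [← Polynomial.C_mul, ← C_mul, inv_mul_cancel₀ hu, C_1, Polynomial.C_1]
  have hmap : (staircaseIdeal L I).map (lineHom σ d).toRingHom =
      coeffIdeal (extendByTop I) (extendByTop_monotone hI) := by
    refine le_antisymm ?_ fun f hf => ?_
    · rw [Ideal.map_le_iff_le_comap]
      refine staircaseIdeal_le (fun j g hg => ?_) ?_
      · obtain ⟨u, hu, h⟩ := lineHom_initialProd (σ := σ) hL hd j.2.le
        rw [Ideal.mem_comap]
        intro n
        rw [AlgHom.toRingHom_eq_coe, RingHom.coe_coe, map_mul, h, lineHom_rename_inr,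
          Polynomial.coeff_mul_C, Polynomial.coeff_C_mul_X_pow]
        split_ifs with hn
        · subst hn
          rw [extendByTop, dif_pos j.2]
          exact Ideal.mul_mem_left _ _ hg
        · simp
      · obtain ⟨u, hu, h⟩ := lineHom_initialProd (σ := σ) hL hd le_rfl
        rw [Ideal.mem_comap]
        intro n
        rw [AlgHom.toRingHom_eq_coe, RingHom.coe_coe, h, Polynomial.coeff_C_mul_X_pow]
        split_ifs with hn
        · simp [extendByTop, hn]
        · simp
    · rw [f.as_sum_support_C_mul_X_pow]
      refine sum_mem fun n _ => ?_
      by_cases hn : n < t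
      · obtain ⟨u, hu, h⟩ := lineHom_initialProd (σ := σ) hL hd hn.le
        have hfn := hf n
        rw [extendByTop, dif_pos hn] at hfn
        have hmem := Ideal.mem_map_of_mem (lineHom σ d).toRingHom
          (mul_mem_staircaseIdeal (L := L) (I := I) ⟨n, hn⟩
            (Ideal.mem_map_of_mem (rename (Sum.inr : σ → Fin 2 ⊕ σ)) hfn))
        have himg : (lineHom σ d).toRingHom (rename Sum.inl (initialProd L n) *
            rename Sum.inr (f.coeff n)) =
              Polynomial.C (C u) * Polynomial.X ^ n * Polynomial.C (f.coeff n) := by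
          rw [AlgHom.toRingHom_eq_coe, RingHom.coe_coe, map_mul, h, lineHom_rename_inr]
        rw [himg] at hmem
        convert Ideal.mul_mem_left _ (Polynomial.C (C u⁻¹)) hmem using 1
        linear_combination (-Polynomial.C (f.coeff n) * Polynomial.X ^ n) * hunit u hu
      · obtain ⟨u, hu, h⟩ := lineHom_initialProd (σ := σ) hL hd le_rfl
        have hmem := Ideal.mem_map_of_mem (lineHom σ d).toRingHom
          (initialProd_mem_staircaseIdeal L I)
        have himg : (lineHom σ d).toRingHom (rename Sum.inl (initialProd L t)) =
            Polynomial.C (C u) * Polynomial.X ^ t := h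
        rw [himg] at hmem
        convert Ideal.mul_mem_left _
          (Polynomial.C (C u⁻¹) * Polynomial.C (f.coeff n) * Polynomial.X ^ (n - t)) hmem using 1
        rw [← pow_sub_mul_pow _ (not_lt.1 hn)]
        linear_combination (-Polynomial.C (f.coeff n) * Polynomial.X ^ (n - t) *
          Polynomial.X ^ t) * hunit u hu
  rw [← hmap, Ideal.comap_map_of_surjective' _ hsurj]
  exact congrArg _ (ker_lineHom hd0 hl hl0 hld).symm

theorem exists_forall_eval_ne_zero [Infinite k] {t : ℕ} (ht : 0 < t)
    {L : Fin t → MvPolynomial (Fin 2) k} (hL : ∀ j, (L j).IsHomogeneous 1) (hL0 : ∀ j, L j ≠ 0) :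
    ∃ d : Fin 2 → k, d ≠ 0 ∧ ∀ j, eval d (L j) ≠ 0 := by
  have h : ∏ j, L j ≠ 0 := Finset.prod_ne_zero_iff.2 fun j _ => hL0 j
  obtain ⟨d, hd⟩ : ∃ d, eval d (∏ j, L j) ≠ 0 := by
    by_contra! hc
    exact h (MvPolynomial.funext fun d => by rw [hc, map_zero])
  rw [map_prod, Finset.prod_ne_zero_iff] at hd
  refine ⟨d, ?_, fun j => hd j (Finset.mem_univ j)⟩
  rintro rfl
  obtain ⟨α, β, h⟩ := (hL ⟨0, ht⟩).exists_eq_linear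
  exact hd ⟨0, ht⟩ (Finset.mem_univ _) (by simp [h])

theorem isACM_levelIdeal [Infinite k] [Finite σ] [Finite ι] {t : ℕ} (ht : 0 < t) {π : σ → ι}
    {v : T → σ → k} (hv : ∀ y i, ∃ q, π q = i ∧ v y q ≠ 0)
    {p : Fin t → Fin 2 → k} {Y : Fin t → Set T} (hY : Antitone Y) (hYfin : ∀ j, (Y j).Finite)
    (hYne : ∀ j, (Y j).Nonempty)
    {L : Fin t → MvPolynomial (Fin 2) k} (hL : ∀ j, (L j).IsHomogeneous 1) (hL0 : ∀ j, L j ≠ 0)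
    (hp : ∀ j, p j ≠ 0) (hLp : ∀ i j, eval (p i) (L j) = 0 ↔ i = j)
    (hACM : ∀ j, IsACM (⨅ y ∈ Y j, coneIdeal π (v y))) :
    IsACM (levelIdeal π v p Y) := by
  have hle : ∀ j, ⨅ y ∈ Y j, coneIdeal π (v y) ≤ Ideal.span (Set.range X) := fun j => by
    obtain ⟨y, hy⟩ := hYne j
    exact (biInf_le _ hy).trans (coneIdeal_le_span_X _ _)
  obtain ⟨rs, hlen, hrs, hreg⟩ := exists_seqRegularMod_of_finite (n := Nat.card ι)
    (I := Ideal.span (Set.range X)) (J := fun j => ⨅ y ∈ Y j, coneIdeal π (v y)) fun j => by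
      obtain ⟨rs, hlen, hrs, hreg⟩ := (isACM_iff (hle j) (ringKrullDim_quotient_biInf (hYfin j)
        (hYne j) _ fun y _ => ringKrullDim_quotient_coneIdeal (hv y))).1 (hACM j)
      exact hlen ▸ hreg.depthGE hrs
  set Z : Set (Fin t × T) := {z | z.2 ∈ Y z.1} with hZ
  have hlevel : levelIdeal π v p Y = ⨅ z ∈ Z,
      coneIdeal (Sum.map (fun _ : Fin 2 => ()) π) (Sum.elim (p z.1) (v z.2)) := by
    ext F
    simp [mem_levelIdeal, Submodule.mem_iInf, hZ]
  have hZfin : Z.Finite := by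
    refine (Set.finite_iUnion fun j => (hYfin j).image (Prod.mk j)).subset ?_
    rintro ⟨j, y⟩ hz
    exact Set.mem_iUnion.2 ⟨j, y, hz, rfl⟩
  obtain ⟨y₀, hy₀⟩ := hYne ⟨0, ht⟩
  have hz₀ : ((⟨0, ht⟩, y₀) : Fin t × T) ∈ Z := hy₀
  have hdim : ringKrullDim (MvPolynomial (Fin 2 ⊕ σ) k ⧸ levelIdeal π v p Y) =
      (Nat.card ι + 1 : ℕ) := by
    rw [hlevel]
    refine ringKrullDim_quotient_biInf hZfin ⟨_, hz₀⟩ _ fun z _ => ?_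
    rw [ringKrullDim_quotient_coneIdeal, Nat.card_sum, Nat.card_unique, add_comm]
    rintro (i | i)
    · obtain ⟨j, hj⟩ := Function.ne_iff.1 (hp z.1)
      exact ⟨Sum.inl j, rfl, hj⟩
    · obtain ⟨q, rfl, hq⟩ := hv z.2 i
      exact ⟨Sum.inr q, rfl, hq⟩
  rw [isACM_iff _ hdim]
  swap
  · rw [hlevel]
    exact (biInf_le _ hz₀).trans (coneIdeal_le_span_X _ _)
  obtain ⟨d, hd0, hd⟩ := exists_forall_eval_ne_zero ht hL hL0
  set l : MvPolynomial (Fin 2) k := C (d 1) * X 0 + C (- d 0) * X 1 with hl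
  have hl1 : l.IsHomogeneous 1 := (isHomogeneous_C_mul_X _ _).add (isHomogeneous_C_mul_X _ _)
  have hleval : ∀ e, eval e l = d 1 * e 0 - d 0 * e 1 := fun e => by simp [hl]; ring
  have hl0 : l ≠ 0 := by
    intro h
    apply hd0
    ext i
    fin_cases i
    · have := hleval ![0, 1]
      simpa [h] using this
    · have := hleval ![1, 0]
      simpa [h] using this.symm
  have hld : eval d l = 0 := by rw [hleval]; ring
  refine ⟨rename Sum.inl l :: rs.map (rename Sum.inr), by simp [hlen], ?_, ?_, ?_⟩
  · have hren : ∀ {τ : Type} (f : τ → Fin 2 ⊕ σ), Ideal.span (Set.range X) ≤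
        (Ideal.span (Set.range X)).comap (rename f : MvPolynomial τ k →ₐ[k] _) := by
      intro τ f
      rw [Ideal.span_le]
      rintro _ ⟨i, rfl⟩
      simpa using Ideal.subset_span (Set.mem_range_self (f i))
    intro r hr
    rcases List.mem_cons.1 hr with rfl | hr
    · refine hren _ ?_
      exact add_mem (Ideal.mul_mem_left _ _ (Ideal.subset_span ⟨0, rfl⟩))
        (Ideal.mul_mem_left _ _ (Ideal.subset_span ⟨1, rfl⟩))
    · obtain ⟨r, hr', rfl⟩ := List.mem_map.1 hr
      exact hren _ (hrs r hr')
  · intro F hF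
    rw [mem_levelIdeal] at hF ⊢
    refine fun j y hy => ((coneIdeal_isPrime _ _).mem_or_mem (hF j y hy)).resolve_left ?_
    rw [rename_inl_mem_coneIdeal_iff hl1]
    intro h
    refine hd j ((eval_eq_zero_iff_proportional (hL j) (hL0 j) (hp j) ((hLp j j).2 rfl)).2 ?_)
    rw [hleval] at h
    linear_combination -h
  · have hmono : Monotone fun j => ⨅ y ∈ Y j, coneIdeal π (v y) :=
      fun i j hij => biInf_mono (hY hij)
    have hsurj : Function.Surjective (lineHom σ d).toRingHom := lineHom_surjective hd0
    have hmap : (rs.map (rename Sum.inr)).map (lineHom σ d).toRingHom = rs.map Polynomial.C := by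
      rw [List.map_map]
      exact List.map_congr_left fun f _ => lineHom_rename_inr d f
    rw [levelIdeal_eq_staircaseIdeal hY hL hL0 hp hLp,
      staircaseIdeal_sup_span hL hd0 hd hl1 hl0 hld hmono, SeqRegularMod.comap hsurj, hmap]
    refine SeqRegularMod.coeffIdeal _ fun n => ?_
    unfold extendByTop
    split_ifs with h
    · exact hreg _
    · exact seqRegularMod_top _

end LevelSets

section VanishingIdeals

open MvPolynomial

variable {k : Type} [Field k]

theorem vanishPi_eq_iInf_coneIdeal [Infinite k] {m : ℕ} {a : Fin m → ℕ}
    (Y : Set (∀ i, Pt k (a i))) :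
    vanishPi k Y = ⨅ y ∈ Y, coneIdeal Sigma.fst fun q => (y q.1).rep q.2 := by
  ext F
  simp only [vanishPi, Submodule.mem_iInf, mem_coneIdeal, RingHom.mem_ker]

theorem vanishP1Pi_eq_levelIdeal [Infinite k] {m : ℕ} {a : Fin m → ℕ}
    {X : Set (Pt k 1 × ∀ i, Pt k (a i))} {t : ℕ} {P : Fin t → Pt k 1}
    (hP : Set.range P = Prod.fst '' X) :
    vanishP1Pi k X = levelIdeal Sigma.fst (fun (y : ∀ i, Pt k (a i)) q => (y q.1).rep q.2)
      (fun j => (P j).rep) fun j => {y | (P j, y) ∈ X} := by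
  have hpt : ∀ (p : Fin 2 → k) (w : (i : Fin m) × Fin (a i + 1) → k) (c : Unit ⊕ Fin m → k),
      (fun q => c (Sum.map (fun _ : Fin 2 => ()) Sigma.fst q) * Sum.elim p w q) =
        Sum.elim (c (Sum.inl ()) • p) fun q => c (Sum.inr q.1) * w q := by
    intro p w c
    ext (i | q) <;> simp
  ext F
  simp only [vanishP1Pi, Submodule.mem_iInf, mem_levelIdeal, mem_coneIdeal, RingHom.mem_ker, hpt]
  refine ⟨fun h j y hy c => h (P j, y) hy _ fun i => c (Sum.inr i), fun h z hz s c => ?_⟩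
  obtain ⟨j, hj⟩ : z.1 ∈ Set.range P := hP ▸ Set.mem_image_of_mem _ hz
  have hzj : (P j, z.2) ∈ X := by rwa [hj]
  have := h j z.2 hzj (Sum.elim (fun _ => s) c)
  rwa [hj] at this

theorem Projectivization.eq_of_proportional {p d : Pt k 1}
    (h : p.rep 1 * d.rep 0 = p.rep 0 * d.rep 1) : d = p := by
  obtain ⟨w, hw⟩ := exists_dotProduct_fin_two_eq_one p.rep_nonzero
  rw [← d.mk_rep, ← p.mk_rep, Projectivization.mk_eq_mk_iff']
  refine ⟨w 0 * d.rep 0 + w 1 * d.rep 1, ?_⟩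
  ext i
  fin_cases i
  · simp only [Fin.zero_eta, Pi.smul_apply, smul_eq_mul]
    linear_combination d.rep 0 * hw - w 1 * h
  · simp only [Fin.mk_one, Pi.smul_apply, smul_eq_mul]
    linear_combination d.rep 1 * hw + w 0 * h

end VanishingIdeals

/-- **Proposition (inclusion implies ACM in `ℙ^1 × ℙ^{a₂} × ⋯ × ℙ^{a_n}`).**
Let `X ⊆ ℙ^1 × ℙ^{a₂} × ⋯ × ℙ^{a_n}` be a finite set, with level sets `X₁, …, X_t` with
respect to `η₁` (the fibers over `η₁(X) = {P₁, …, P_t} ⊆ ℙ^1`), let `Y_i = π₁(X_i)`, and let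
`L₁, …, L_t ∈ k[x₀,x₁]` be the linear forms defining the points `P₁, …, P_t`.  Assume `X`
has the inclusion property with respect to `π₁`: each `Y_i` is ACM and
`Y₁ ⊇ Y₂ ⊇ ⋯ ⊇ Y_t`.  Then `X` is ACM and
`I_X = I_{Y₁} + L₁·I_{Y₂} + L₁L₂·I_{Y₃} + ⋯ + L₁⋯L_{t-1}·I_{Y_t} + (L₁⋯L_t)`. -/
theorem inclusion_implies_ACM_P1_multiproj [CharZero k]
    {m : ℕ} (hm : 0 < m) (a : Fin m → ℕ)
    (X : Set (Pt k 1 × ∀ i, Pt k (a i))) (hfin : X.Finite)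
    (t : ℕ) (ht : 0 < t)
    (P : Fin t → Pt k 1) (hPinj : Function.Injective P)
    (hPrange : Set.range P = Prod.fst '' X)
    (Y : Fin t → Set (∀ i, Pt k (a i)))
    (hY : ∀ j, Y j = {y | (P j, y) ∈ X})
    (L : Fin t → MvPolynomial (Fin 2) k)
    (hL1 : ∀ j, (L j).IsHomogeneous 1) (hL0 : ∀ j, L j ≠ 0)
    (hLv : ∀ j, ∀ s : k, MvPolynomial.eval (s • (P j).rep) (L j) = 0)
    (hACM : ∀ j, IsACM (vanishPi k (Y j)))
    (hchain : ∀ i j : Fin t, i ≤ j → Y j ⊆ Y i) :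
    IsACM (vanishP1Pi k X) ∧
    vanishP1Pi k X =
      (∑ j : Fin t,
        Ideal.span
            {MvPolynomial.rename
              (Sum.inl : Fin 2 → Fin 2 ⊕ (i : Fin m) × Fin (a i + 1))
              (∏ i ∈ Finset.univ.filter (fun i => i < j), L i)} *
          Ideal.map
            (MvPolynomial.rename
              (Sum.inr : ((i : Fin m) × Fin (a i + 1)) → Fin 2 ⊕ (i : Fin m) × Fin (a i + 1)))
            (vanishPi k (Y j))) +
      Ideal.span
        {MvPolynomial.rename (Sum.inl : Fin 2 → Fin 2 ⊕ (i : Fin m) × Fin (a i + 1))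
          (∏ i : Fin t, L i)} := by
  have hrep : ∀ j, (P j).rep ≠ 0 := fun j => (P j).rep_nonzero
  have hLp : ∀ i j, MvPolynomial.eval (P i).rep (L j) = 0 ↔ i = j := by
    have hself : ∀ j, MvPolynomial.eval (P j).rep (L j) = 0 := fun j => by
      simpa using hLv j 1
    intro i j
    refine ⟨fun h => hPinj ?_, fun h => h ▸ hself i⟩
    exact Projectivization.eq_of_proportional
      ((eval_eq_zero_iff_proportional (hL1 j) (hL0 j) (hrep j) (hself j)).1 h)
  obtain rfl : Y = fun j => {y | (P j, y) ∈ X} := funext hY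
  have hYne : ∀ j, {y | (P j, y) ∈ X}.Nonempty := fun j => by
    obtain ⟨⟨p, y⟩, hz, hj⟩ := hPrange ▸ Set.mem_range_self j
    exact ⟨y, by simpa [← hj] using hz⟩
  have hYfin : ∀ j, {y | (P j, y) ∈ X}.Finite := fun j =>
    hfin.preimage (Prod.mk_right_injective (P j)).injOn
  have hv : ∀ (y : ∀ i, Pt k (a i)) (i : Fin m),
      ∃ q : (i : Fin m) × Fin (a i + 1), q.1 = i ∧ (y q.1).rep q.2 ≠ 0 := fun y i => by
    obtain ⟨j, hj⟩ := Function.ne_iff.1 (y i).rep_nonzero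
    exact ⟨⟨i, j⟩, rfl, hj⟩
  have hanti : Antitone fun j => {y | (P j, y) ∈ X} := fun i j hij => hchain i j hij
  rw [vanishP1Pi_eq_levelIdeal hPrange]
  simp only [vanishPi_eq_iInf_coneIdeal] at hACM ⊢
  refine ⟨isACM_levelIdeal ht hv hanti hYfin hYne hL1 hL0 hrep hLp hACM, ?_⟩
  rw [levelIdeal_eq_staircaseIdeal hanti hL1 hL0 hrep hLp, staircaseIdeal, initialProd_length]
  rfl

end
end

section
/- Let X be a finite set of points in P^{a_1} × P^{a_2}. Then X satisfies the inclusion property with respect to π_1 if and only if X satisfies the (⋆)-property. -/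
noncomputable section

variable (k : Type) [Field k]

/-- The homogeneous (saturated) vanishing ideal of a set of points of `ℙ^m`:
all polynomials vanishing on the affine cone over the points. -/
def vanishP {m : ℕ} (Z : Set (Pt k m)) : Ideal (MvPolynomial (Fin (m + 1)) k) :=
  ⨅ (q : Pt k m) (_ : q ∈ Z) (s : k),
    RingHom.ker (MvPolynomial.eval (s • q.rep))

/-- The bihomogeneous (saturated) vanishing ideal of a set of points of `ℙ^a × ℙ^b`:
all polynomials vanishing on the multicone over the points. -/
def vanishP2 {a b : ℕ} (X : Set (Pt k a × Pt k b)) :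
    Ideal (MvPolynomial (Fin (a + 1) ⊕ Fin (b + 1)) k) :=
  ⨅ (p : Pt k a × Pt k b) (_ : p ∈ X) (s : k) (t : k),
    RingHom.ker (MvPolynomial.eval (Sum.elim (s • p.1.rep) (t • p.2.rep)))

/-- The `(⋆)`-property for a finite set of points in `ℙ^a × ℙ^b`. -/
def StarProp {a b : ℕ} (X : Set (Pt k a × Pt k b)) : Prop :=
  ∀ p ∈ X, ∀ q ∈ X, (p.1, q.2) ∈ X ∨ (q.1, p.2) ∈ X

/-- The image under `π₁` of the level set of `X ⊆ ℙ^a × ℙ^b` over a point `P ∈ ℙ^a`: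
`π₁(X_i) = {Q : (P_i, Q) ∈ X}` when `P = P_i`. -/
def levelImage2 {a b : ℕ} (X : Set (Pt k a × Pt k b)) (P : Pt k a) : Set (Pt k b) :=
  {q | (P, q) ∈ X}

/-- `X ⊆ ℙ^a × ℙ^b` has the *inclusion property* with respect to `π₁`: the images
`π₁(X_1), …, π₁(X_t)` of its level sets are totally ordered by inclusion and each of them
is ACM. -/
def InclusionProp2 {a b : ℕ} (X : Set (Pt k a × Pt k b)) : Prop :=
  (∀ P₁ P₂ : Pt k a,
    levelImage2 k X P₁ ⊆ levelImage2 k X P₂ ∨ levelImage2 k X P₂ ⊆ levelImage2 k X P₁) ∧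
  ∀ P ∈ Prod.fst '' X, IsACM (vanishP k (levelImage2 k X P))

/-- An integral extension does not have larger Krull dimension. -/
theorem ringKrullDim_le_of_algebraIsIntegral {R S : Type*} [CommRing R] [CommRing S]
    [Algebra R S] [Algebra.IsIntegral R S] : ringKrullDim S ≤ ringKrullDim R :=
  Order.krullDim_le_of_strictMono (PrimeSpectrum.comap (algebraMap R S)) fun _ _ h =>
    Ideal.IsIntegral.comap_lt_comap h

section VanishingIdeal

variable {k} {m : ℕ}

open MvPolynomial

theorem mem_vanishP {Z : Set (Pt k m)} {f : MvPolynomial (Fin (m + 1)) k} :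
    f ∈ vanishP k Z ↔ ∀ q ∈ Z, ∀ s : k, eval (s • q.rep) f = 0 := by
  simp [vanishP, RingHom.mem_ker]

/-- The linear form in the coordinates given by a linear functional. -/
def linearForm (φ : Module.Dual k (Fin (m + 1) → k)) : MvPolynomial (Fin (m + 1)) k :=
  ∑ i, C (φ (Pi.single i 1)) * X i

theorem eval_linearForm (φ : Module.Dual k (Fin (m + 1) → k)) (v : Fin (m + 1) → k) :
    eval v (linearForm φ) = φ v := by
  conv_rhs => rw [← (Pi.basisFun k (Fin (m + 1))).sum_repr v]
  simp [linearForm, mul_comm]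

theorem linearForm_mem_span_X (φ : Module.Dual k (Fin (m + 1) → k)) :
    linearForm φ ∈
      Ideal.span (Set.range (X : Fin (m + 1) → MvPolynomial (Fin (m + 1)) k)) :=
  Ideal.sum_mem _ fun i _ => Ideal.mul_mem_left _ _ (Ideal.subset_span ⟨i, rfl⟩)

theorem exists_dual_ne_zero_on_points [Infinite k] {Z : Set (Pt k m)} (hZ : Z.Finite) :
    ∃ φ : Module.Dual k (Fin (m + 1) → k), ∀ q ∈ Z, φ q.rep ≠ 0 := by
  have := hZ.to_subtype
  obtain ⟨φ, hφ⟩ := Module.exists_dual_forall_apply_ne_zero (K := k)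
    (fun q : Z => q.1.rep) fun q => q.1.rep_nonzero
  exact ⟨φ, fun q hq => hφ ⟨q, hq⟩⟩

/-- A linear form vanishing at no point of `Z` is a nonzerodivisor modulo the ideal of `Z`. -/
theorem mk_linearForm_mem_nonZeroDivisors [Infinite k] {Z : Set (Pt k m)}
    {φ : Module.Dual k (Fin (m + 1) → k)} (hφ : ∀ q ∈ Z, φ q.rep ≠ 0) :
    Ideal.Quotient.mk (vanishP k Z) (linearForm φ) ∈
      nonZeroDivisors (MvPolynomial (Fin (m + 1)) k ⧸ vanishP k Z) := by
  rw [mem_nonZeroDivisors_iff_right]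
  intro x hx
  obtain ⟨f, rfl⟩ := Ideal.Quotient.mk_surjective x
  rw [← map_mul, Ideal.Quotient.eq_zero_iff_mem, mem_vanishP] at hx
  rw [Ideal.Quotient.eq_zero_iff_mem, mem_vanishP]
  intro q hq
  let p : Polynomial k := aeval (fun i => Polynomial.C (q.rep i) * Polynomial.X) f
  have hp (s : k) : p.eval s = eval (s • q.rep) f := by
    rw [← Polynomial.coe_evalRingHom, ← MvPolynomial.coe_aeval_eq_eval,
      ← Polynomial.coe_aeval_eq_evalRingHom]
    change ((Polynomial.aeval s).comp (aeval fun i => Polynomial.C (q.rep i) * Polynomial.X)) f =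
      aeval (s • q.rep) f
    congr 1
    ext i
    simp only [AlgHom.comp_apply, aeval_X, map_mul, Polynomial.aeval_X, Polynomial.aeval_C,
      Algebra.algebraMap_self, RingHom.id_apply, Pi.smul_apply, smul_eq_mul]
    ring
  have hzero : p * (Polynomial.C (φ q.rep) * Polynomial.X) = 0 := by
    refine Polynomial.funext fun s => ?_
    have := hx q hq s
    rw [map_mul, eval_linearForm, map_smul, smul_eq_mul, mul_comm s] at this
    simpa only [Polynomial.eval_mul, Polynomial.eval_C, Polynomial.eval_X, Polynomial.eval_zero,
      hp] using this
  have hp0 : p = 0 := (mul_eq_zero.mp hzero).resolve_right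
    (mul_ne_zero (Polynomial.C_ne_zero.mpr (hφ q hq)) Polynomial.X_ne_zero)
  intro s
  rw [← hp, hp0, Polynomial.eval_zero]

/-- The coordinate ring of a finite set of points of `ℙ^m` has Krull dimension at most one. -/
theorem ringKrullDim_quotient_vanishP_le_one {Z : Set (Pt k m)} (hZ : Z.Finite)
    {φ : Module.Dual k (Fin (m + 1) → k)} (hφ : ∀ q ∈ Z, φ q.rep ≠ 0) :
    ringKrullDim (MvPolynomial (Fin (m + 1)) k ⧸ vanishP k Z) ≤ 1 := by
  let g : Polynomial k →ₐ[k] MvPolynomial (Fin (m + 1)) k ⧸ vanishP k Z :=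
    Polynomial.aeval (Ideal.Quotient.mk (vanishP k Z) (linearForm φ))
  have hX (i : Fin (m + 1)) : g.toRingHom.IsIntegralElem (Ideal.Quotient.mk _ (X i)) := by
    refine ⟨∏ q ∈ hZ.toFinset, (Polynomial.X -
      Polynomial.C (Polynomial.C (q.rep i / φ q.rep) * Polynomial.X)),
      Polynomial.monic_prod_of_monic _ _ fun q _ => Polynomial.monic_X_sub_C _, ?_⟩
    have h : (∏ q ∈ hZ.toFinset, (X i - C (q.rep i / φ q.rep) * linearForm φ)) ∈
        vanishP k Z := by
      refine mem_vanishP.mpr fun q hq s => ?_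
      rw [map_prod]
      refine Finset.prod_eq_zero (hZ.mem_toFinset.mpr hq) ?_
      have := hφ q hq
      simp only [map_sub, map_mul, eval_X, eval_C, eval_linearForm, map_smul, Pi.smul_apply,
        smul_eq_mul]
      field_simp
      ring
    rw [← Ideal.Quotient.eq_zero_iff_mem, map_prod] at h
    rw [Polynomial.eval₂_finsetProd, ← h]
    refine Finset.prod_congr rfl fun q _ => ?_
    simp [g]
    rfl
  have hg : g.toRingHom.IsIntegral := by
    intro x
    obtain ⟨f, rfl⟩ := Ideal.Quotient.mk_surjective x
    induction f using MvPolynomial.induction_on with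
    | C a =>
      have h : g.toRingHom (Polynomial.C a) = Ideal.Quotient.mk (vanishP k Z) (C a) :=
        g.commutes a
      exact h ▸ g.toRingHom.isIntegralElem_map
    | add p q hp hq => rw [map_add]; exact hp.add _ hq
    | mul_X p i hp => rw [map_mul]; exact hp.mul _ (hX i)
  let _ := g.toRingHom.toAlgebra
  have : Algebra.IsIntegral (Polynomial k) (MvPolynomial (Fin (m + 1)) k ⧸ vanishP k Z) := ⟨hg⟩
  exact (ringKrullDim_le_of_algebraIsIntegral (R := Polynomial k)).trans
    (IsPrincipalIdealRing.ringKrullDim_eq_one _ (Polynomial.not_isField k)).le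

/-- The image of the irrelevant ideal in the coordinate ring of a nonempty set of points
is proper. -/
theorem map_span_X_ne_top {Z : Set (Pt k m)} (hne : Z.Nonempty) :
    Ideal.map (Ideal.Quotient.mk (vanishP k Z))
      (Ideal.span (Set.range (X : Fin (m + 1) → MvPolynomial (Fin (m + 1)) k))) ≠ ⊤ := by
  obtain ⟨q, hq⟩ := hne
  let ε : MvPolynomial (Fin (m + 1)) k ⧸ vanishP k Z →+* k :=
    Ideal.Quotient.lift _ (eval 0) fun f hf => by simpa using mem_vanishP.mp hf q hq 0
  refine ne_top_of_le_ne_top (RingHom.ker_ne_top ε) ?_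
  rw [Ideal.map_le_iff_le_comap, Ideal.span_le]
  rintro _ ⟨i, rfl⟩
  simp [ε, RingHom.mem_ker]

/-- A nonempty finite set of points of `ℙ^m` is arithmetically Cohen–Macaulay. -/
theorem isACM_vanishP_of_finite [Infinite k] {Z : Set (Pt k m)} (hZ : Z.Finite)
    (hne : Z.Nonempty) : IsACM (vanishP k Z) := by
  obtain ⟨φ, hφ⟩ := exists_dual_ne_zero_on_points hZ
  have hreg := mk_linearForm_mem_nonZeroDivisors hφ
  have hmem := Ideal.mem_map_of_mem (Ideal.Quotient.mk (vanishP k Z)) (linearForm_mem_span_X φ)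
  have hspan : Ideal.span {Ideal.Quotient.mk (vanishP k Z) (linearForm φ)} ≠ ⊤ :=
    ne_top_of_le_ne_top (map_span_X_ne_top hne) (by simpa [Ideal.span_le] using hmem)
  refine ⟨[Ideal.Quotient.mk _ (linearForm φ)], by simpa using hmem, ⟨?_, ?_⟩, ?_⟩
  · rw [RingTheory.Sequence.isWeaklyRegular_singleton_iff]
    intro x y h
    exact (mul_cancel_left_mem_nonZeroDivisors hreg).mp h
  · rw [Ideal.ofList_singleton, smul_eq_mul, Ideal.mul_top]
    exact hspan.symm
  · refine le_antisymm ?_ (by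
      simpa using ringKrullDim_quotient_vanishP_le_one hZ hφ)
    have := Ideal.Quotient.nontrivial_iff.mpr hspan
    refine le_trans ?_ (ringKrullDim_quotient_succ_le_of_nonZeroDivisor hreg)
    simpa using add_le_add_left (ringKrullDim_nonneg_of_nontrivial (R := _ ⧸ Ideal.span
      {Ideal.Quotient.mk (vanishP k Z) (linearForm φ)})) 1

end VanishingIdeal

/-- The `(⋆)`-property says that the level sets form a chain under inclusion. -/
theorem starProp_iff_levelImage2_total {a b : ℕ} (X : Set (Pt k a × Pt k b)) :
    StarProp k X ↔ ∀ P₁ P₂ : Pt k a,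
      levelImage2 k X P₁ ⊆ levelImage2 k X P₂ ∨ levelImage2 k X P₂ ⊆ levelImage2 k X P₁ := by
  constructor
  · intro h P₁ P₂
    by_contra! hc
    obtain ⟨⟨Q₁, h₁, h₁'⟩, Q₂, h₂, h₂'⟩ := hc.imp Set.not_subset.mp Set.not_subset.mp
    exact (h (P₁, Q₁) h₁ (P₂, Q₂) h₂).elim h₂' h₁'
  · rintro h ⟨P₁, Q₁⟩ h₁ ⟨P₂, Q₂⟩ h₂
    exact (h P₁ P₂).symm.imp (fun hs => hs h₂) (fun hs => hs h₁)

/-- **Lemma.** A finite set of points `X ⊆ ℙ^{a₁} × ℙ^{a₂}` satisfies the inclusion property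
with respect to `π₁` if and only if it satisfies the `(⋆)`-property. -/
theorem inclusion_iff_star [CharZero k] {a b : ℕ} (X : Set (Pt k a × Pt k b))
    (hfin : X.Finite) :
    InclusionProp2 k X ↔ StarProp k X := by
  rw [starProp_iff_levelImage2_total, InclusionProp2, and_iff_left_iff_imp]
  rintro - P ⟨⟨P', Q⟩, hQ, rfl⟩
  exact isACM_vanishP_of_finite (hfin.preimage (Prod.mk_right_injective _).injOn) ⟨Q, hQ⟩

end
end

section
/- Let V_2 ⊆ V_1 be finite sets of points in P^{a_1} and Z_1 a finite set of points in P^{a_2}, and work in the bigraded coordinate ring R = k[x_0,...,x_{a_1}, y_0,...,y_{a_2}], where I_{V_1\V_2}, I_{V_2}, I_{V_1} ⊆ k[x_0,...,x_{a_1}] and I_{Z_1} ⊆ k[y_0,...,y_{a_2}] are the homogeneous vanishing ideals of the indicated finite sets, extended to R. Then (I_{V_1\V_2} + I_{Z_1}) ∩ I_{V_2} = I_{V_1} + I_{V_2}·I_{Z_1}; in particular, the ideal I_{V_1} + I_{V_2}·I_{Z_1} is saturated with respect to the irrelevant maximal ideal of R. -/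
noncomputable section

variable (k : Type) [Field k]

/-- An ideal `I` of a polynomial ring is *saturated* with respect to the irrelevant maximal
ideal `𝔪` (generated by all the variables): `I = I : 𝔪^∞`. -/
def IsSaturated {k : Type} [Field k] {σ : Type} (I : Ideal (MvPolynomial σ k)) : Prop :=
  ∀ f : MvPolynomial σ k,
    (∃ n : ℕ,
      ∀ g ∈ (Ideal.span (Set.range (MvPolynomial.X : σ → MvPolynomial σ k))) ^ n, g * f ∈ I) →
    f ∈ I

namespace MvPolynomial

variable {K σ τ : Type*} [Field K]

/-- Partial evaluation of the left-hand variables at `s`. -/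
def evalLeft (s : σ → K) : MvPolynomial (σ ⊕ τ) K →ₐ[K] MvPolynomial τ K :=
  aeval (Sum.elim (fun i ↦ C (s i)) X)

@[simp] lemma evalLeft_rename_inl (s : σ → K) (f : MvPolynomial σ K) :
    evalLeft s (rename (Sum.inl : σ → σ ⊕ τ) f) = C (eval s f) := by
  induction f using MvPolynomial.induction_on with
  | C r => simp [evalLeft, algebraMap_eq]
  | add f g hf hg => simp [hf, hg]
  | mul_X f i hf => rw [map_mul, map_mul, hf]; simp [evalLeft]

@[simp] lemma evalLeft_rename_inr (s : σ → K) (g : MvPolynomial τ K) :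
    evalLeft s (rename (Sum.inr : τ → σ ⊕ τ) g) = g := by
  rw [evalLeft, aeval_rename, Sum.elim_comp_inr, aeval_X_left_apply]

lemma eval_evalLeft (s : σ → K) (t : τ → K) (F : MvPolynomial (σ ⊕ τ) K) :
    eval t (evalLeft s F) = eval (Sum.elim s t) F := by
  induction F using MvPolynomial.induction_on with
  | C r => simp [evalLeft, algebraMap_eq]
  | add f g hf hg => simp [hf, hg]
  | mul_X f i hf => rw [map_mul, map_mul, hf]; cases i <;> simp [evalLeft]

/-- The extension of the vanishing ideal of `S` consists of the polynomials whose partial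
evaluations at the points of `S` are zero. -/
lemma mem_map_rename_inl_vanishingIdeal_iff {S : Set (σ → K)} {F : MvPolynomial (σ ⊕ τ) K} :
    F ∈ (vanishingIdeal K S).map (rename (Sum.inl : σ → σ ⊕ τ)) ↔
      ∀ s ∈ S, evalLeft s F = 0 := by
  constructor
  · intro hF s hs
    have : (vanishingIdeal K S).map (rename (Sum.inl : σ → σ ⊕ τ)) ≤
        RingHom.ker (evalLeft (τ := τ) s) := by
      rw [Ideal.map_le_iff_le_comap]
      intro f hf
      have hs0 := hf s hs
      simp only [aeval_eq_eval] at hs0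
      simp [Ideal.mem_comap, RingHom.mem_ker, hs0]
    exact this hF
  · intro hF
    let e : MvPolynomial (σ ⊕ τ) K →ₐ[K] MvPolynomial τ (MvPolynomial σ K) :=
      aeval (Sum.elim (fun i ↦ C (X i)) X)
    let d : MvPolynomial τ (MvPolynomial σ K) →+* MvPolynomial (σ ⊕ τ) K :=
      eval₂Hom (rename (Sum.inl : σ → σ ⊕ τ)).toRingHom (fun j ↦ X (Sum.inr j))
    have hde (G : MvPolynomial (σ ⊕ τ) K) : d (e G) = G := by
      induction G using MvPolynomial.induction_on with
      | C r => simp [d, e, algebraMap_apply, algebraMap_eq]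
      | add f g hf hg => simp [hf, hg]
      | mul_X f i hf => rw [map_mul, map_mul, hf]; cases i <;> simp [d, e]
    have hmap (s : σ → K) (G : MvPolynomial (σ ⊕ τ) K) : map (eval s) (e G) = evalLeft s G := by
      induction G using MvPolynomial.induction_on with
      | C r => simp [evalLeft, e, algebraMap_apply, algebraMap_eq]
      | add f g hf hg => simp [hf, hg]
      | mul_X f i hf => rw [map_mul, map_mul, map_mul, hf]; cases i <;> simp [evalLeft, e]
    have he : e F ∈ (vanishingIdeal K S).map (C : MvPolynomial σ K →+* _) := by
      rw [mem_map_C_iff]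
      intro m s hs
      rw [aeval_eq_eval, ← coeff_map, hmap, hF s hs, coeff_zero]
    have hd := Ideal.mem_map_of_mem d he
    rw [hde, Ideal.map_map] at hd
    convert hd using 1
    have hdC : d.comp C = (rename (Sum.inl : σ → σ ⊕ τ)).toRingHom := by
      ext <;> simp [d]
    rw [hdC]
    rfl

lemma tensorEquivSum_tmul (f : MvPolynomial σ K) (g : MvPolynomial τ K) :
    tensorEquivSum K σ τ K (f ⊗ₜ[K] g) = rename Sum.inl f * rename Sum.inr g := by
  have h : (tensorEquivSum K σ τ K).toAlgHom =
      Algebra.TensorProduct.productMap (rename Sum.inl) (rename Sum.inr) := by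
    ext <;> simp
  exact DFunLike.congr_fun h (f ⊗ₜ[K] g)

/-- Polynomials in two sets of variables are sums of products of polynomials in either set. -/
lemma induction_on_rename_mul {P : MvPolynomial (σ ⊕ τ) K → Prop} (F : MvPolynomial (σ ⊕ τ) K)
    (mul : ∀ f g, P (rename Sum.inl f * rename Sum.inr g))
    (add : ∀ F G, P F → P G → P (F + G)) : P F := by
  obtain ⟨x, rfl⟩ := (tensorEquivSum K σ τ K).surjective F
  induction x with
  | zero => simpa using mul 0 0
  | tmul f g => rw [tensorEquivSum_tmul]; exact mul f g
  | add x y hx hy => rw [map_add]; exact add _ _ hx hy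

/-- Apply a linear endomorphism to the right-hand variables only. -/
def mapRight (p : MvPolynomial τ K →ₗ[K] MvPolynomial τ K) :
    MvPolynomial (σ ⊕ τ) K →ₗ[K] MvPolynomial (σ ⊕ τ) K :=
  (tensorEquivSum K σ τ K).toLinearMap ∘ₗ p.lTensor (MvPolynomial σ K) ∘ₗ
    (tensorEquivSum K σ τ K).symm.toLinearMap

section mapRight

variable (p : MvPolynomial τ K →ₗ[K] MvPolynomial τ K)

lemma mapRight_mul (f : MvPolynomial σ K) (g : MvPolynomial τ K) :
    mapRight p (rename Sum.inl f * rename Sum.inr g) =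
      rename Sum.inl f * rename Sum.inr (p g) := by
  rw [← tensorEquivSum_tmul, ← tensorEquivSum_tmul]
  simp [mapRight]

lemma mapRight_rename_mul (f : MvPolynomial σ K) (F : MvPolynomial (σ ⊕ τ) K) :
    mapRight p (rename Sum.inl f * F) = rename Sum.inl f * mapRight p F := by
  induction F using induction_on_rename_mul with
  | mul f' g => rw [← mul_assoc, ← map_mul, mapRight_mul, mapRight_mul, map_mul, mul_assoc]
  | add F G hF hG => rw [mul_add, map_add, hF, hG, map_add, mul_add]

lemma evalLeft_mapRight (s : σ → K) (F : MvPolynomial (σ ⊕ τ) K) :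
    evalLeft s (mapRight p F) = p (evalLeft s F) := by
  induction F using induction_on_rename_mul with
  | mul f g => simp [mapRight_mul, ← smul_eq_C_mul]
  | add F G hF hG => simp [hF, hG]

variable {p} {J : Ideal (MvPolynomial τ K)}

lemma sub_mapRight_mem (hp : ∀ g, g - p g ∈ J) (F : MvPolynomial (σ ⊕ τ) K) :
    F - mapRight p F ∈ J.map (rename (Sum.inr : τ → σ ⊕ τ)) := by
  induction F using induction_on_rename_mul with
  | mul f g =>
    rw [mapRight_mul, ← mul_sub, ← map_sub]
    exact Ideal.mul_mem_left _ _ (Ideal.mem_map_of_mem _ (hp g))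
  | add F G hF hG =>
    rw [map_add, add_sub_add_comm]
    exact add_mem hF hG

lemma sub_mapRight_mem_mul (hp : ∀ g, g - p g ∈ J) {I : Ideal (MvPolynomial σ K)}
    {F : MvPolynomial (σ ⊕ τ) K} (hF : F ∈ I.map (rename (Sum.inl : σ → σ ⊕ τ))) :
    F - mapRight p F ∈ I.map (rename (Sum.inl : σ → σ ⊕ τ)) *
      J.map (rename (Sum.inr : τ → σ ⊕ τ)) := by
  suffices h : ∀ G, G * F - mapRight p (G * F) ∈ I.map (rename (Sum.inl : σ → σ ⊕ τ)) *
      J.map (rename (Sum.inr : τ → σ ⊕ τ)) by simpa using h 1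
  induction hF using Submodule.span_induction with
  | mem x hx =>
    obtain ⟨f, hf, rfl⟩ := hx
    intro G
    rw [mul_comm G, mapRight_rename_mul, ← mul_sub]
    exact Ideal.mul_mem_mul (Ideal.mem_map_of_mem _ hf) (sub_mapRight_mem hp G)
  | zero => simp
  | add x y _ _ hx hy =>
    intro G
    rw [mul_add, map_add, add_sub_add_comm]
    exact add_mem (hx G) (hy G)
  | smul a x _ hx =>
    intro G
    simpa only [smul_eq_mul, mul_assoc] using hx (G * a)

end mapRight

lemma exists_linearMap_eq_zero_and_sub_mem (J : Ideal (MvPolynomial τ K)) :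
    ∃ p : MvPolynomial τ K →ₗ[K] MvPolynomial τ K,
      (∀ g ∈ J, p g = 0) ∧ ∀ g, g - p g ∈ J := by
  obtain ⟨Q, hQ⟩ := (J.restrictScalars K).exists_isCompl
  exact ⟨Q.projection _ hQ.symm,
    fun g hg ↦ (Submodule.projection_apply_eq_zero_iff hQ.symm).2 hg,
    fun g ↦ Submodule.sub_projection_mem hQ.symm g⟩

lemma evalLeft_mem_of_mem_map_rename_inr {J : Ideal (MvPolynomial τ K)} (s : σ → K)
    {F : MvPolynomial (σ ⊕ τ) K} (hF : F ∈ J.map (rename (Sum.inr : τ → σ ⊕ τ))) :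
    evalLeft s F ∈ J := by
  have h : J.map (rename (Sum.inr : τ → σ ⊕ τ)) ≤ J.comap (evalLeft s) :=
    Ideal.map_le_iff_le_comap.2 fun g hg ↦ by simpa [Ideal.mem_comap] using hg
  exact h hF

lemma mapRight_mem_map_rename_inl {S : Set (σ → K)} {J : Ideal (MvPolynomial τ K)}
    {p : MvPolynomial τ K →ₗ[K] MvPolynomial τ K} (hp : ∀ g ∈ J, p g = 0)
    {F : MvPolynomial (σ ⊕ τ) K} (hF : ∀ s ∈ S, evalLeft s F ∈ J) :
    mapRight p F ∈ (vanishingIdeal K S).map (rename (Sum.inl : σ → σ ⊕ τ)) :=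
  mem_map_rename_inl_vanishingIdeal_iff.2 fun s hs ↦ by
    rw [evalLeft_mapRight, hp _ (hF s hs)]

lemma mem_map_vanishingIdeal_add_map_iff {S : Set (σ → K)} {J : Ideal (MvPolynomial τ K)}
    {F : MvPolynomial (σ ⊕ τ) K} :
    F ∈ (vanishingIdeal K S).map (rename (Sum.inl : σ → σ ⊕ τ)) +
        J.map (rename (Sum.inr : τ → σ ⊕ τ)) ↔ ∀ s ∈ S, evalLeft s F ∈ J := by
  constructor
  · intro hF s hs
    obtain ⟨G, hG, H, hH, rfl⟩ := Submodule.mem_sup.1 hF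
    rw [map_add, mem_map_rename_inl_vanishingIdeal_iff.1 hG s hs, zero_add]
    exact evalLeft_mem_of_mem_map_rename_inr s hH
  · intro hF
    obtain ⟨p, hp0, hp⟩ := exists_linearMap_eq_zero_and_sub_mem J
    exact Submodule.mem_sup.2 ⟨_, mapRight_mem_map_rename_inl hp0 hF, _, sub_mapRight_mem hp F,
      add_sub_cancel _ _⟩

theorem map_vanishingIdeal_add_map_inf (S₁ S₂ : Set (σ → K)) (J : Ideal (MvPolynomial τ K)) :
    ((vanishingIdeal K S₁).map (rename (Sum.inl : σ → σ ⊕ τ)) +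
        J.map (rename (Sum.inr : τ → σ ⊕ τ))) ⊓
        (vanishingIdeal K S₂).map (rename (Sum.inl : σ → σ ⊕ τ)) =
      (vanishingIdeal K (S₁ ∪ S₂)).map (rename (Sum.inl : σ → σ ⊕ τ)) +
        (vanishingIdeal K S₂).map (rename (Sum.inl : σ → σ ⊕ τ)) *
          J.map (rename (Sum.inr : τ → σ ⊕ τ)) := by
  apply le_antisymm
  · rintro F ⟨hF₁, hF₂⟩
    obtain ⟨p, hp0, hp⟩ := exists_linearMap_eq_zero_and_sub_mem J
    refine Submodule.mem_sup.2 ⟨_, mapRight_mem_map_rename_inl hp0 ?_, _,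
      sub_mapRight_mem_mul hp hF₂, add_sub_cancel _ _⟩
    rintro s (hs | hs)
    · exact mem_map_vanishingIdeal_add_map_iff.1 hF₁ s hs
    · rw [mem_map_rename_inl_vanishingIdeal_iff.1 hF₂ s hs]
      exact J.zero_mem
  · refine sup_le (le_inf ?_ ?_) (le_inf ?_ Ideal.mul_le_left)
    · exact (Ideal.map_mono (vanishingIdeal_anti_mono Set.subset_union_left)).trans le_sup_left
    · exact Ideal.map_mono (vanishingIdeal_anti_mono Set.subset_union_right)
    · exact Ideal.mul_le_right.trans le_sup_right

end MvPolynomial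

section

open MvPolynomial

variable {K : Type} [Field K] {σ τ : Type}

lemma IsSaturated.inf {I J : Ideal (MvPolynomial σ K)} (hI : IsSaturated I)
    (hJ : IsSaturated J) : IsSaturated (I ⊓ J) := by
  rintro f ⟨n, hn⟩
  exact ⟨hI f ⟨n, fun g hg ↦ (hn g hg).1⟩, hJ f ⟨n, fun g hg ↦ (hn g hg).2⟩⟩

lemma X_pow_mem_span_range_X_pow (i : σ) (n : ℕ) :
    (X i : MvPolynomial σ K) ^ n ∈ Ideal.span (Set.range X) ^ n :=
  Ideal.pow_mem_pow (Ideal.subset_span (Set.mem_range_self i)) n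

lemma isSaturated_map_vanishingIdeal [Nonempty τ] (S : Set (σ → K)) :
    IsSaturated ((vanishingIdeal K S).map (rename (Sum.inl : σ → σ ⊕ τ))) := by
  rintro f ⟨n, hn⟩
  rw [mem_map_rename_inl_vanishingIdeal_iff]
  intro s hs
  obtain ⟨j⟩ := ‹Nonempty τ›
  have h := mem_map_rename_inl_vanishingIdeal_iff.1
    (hn _ (X_pow_mem_span_range_X_pow (Sum.inr j) n)) s hs
  simpa [evalLeft, X_ne_zero] using h

/-- The affine cone over a set of points of projective space. -/
def affineCone {m : ℕ} (Z : Set (Pt K m)) : Set (Fin (m + 1) → K) :=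
  {x | ∃ q ∈ Z, ∃ s : K, s • q.rep = x}

lemma affineCone_union {m : ℕ} (Z W : Set (Pt K m)) :
    affineCone (Z ∪ W) = affineCone Z ∪ affineCone W := by
  ext x
  simp only [affineCone, Set.mem_union, Set.mem_ofPred_eq, or_and_right, exists_or]

lemma vanishP_eq_vanishingIdeal {m : ℕ} (Z : Set (Pt K m)) :
    vanishP K Z = vanishingIdeal K (affineCone Z) := by
  ext f
  simp only [vanishP, affineCone, Submodule.mem_iInf, RingHom.mem_ker, mem_vanishingIdeal_iff,
    aeval_eq_eval, Set.mem_ofPred_eq]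
  constructor
  · rintro h _ ⟨q, hq, s, rfl⟩
    exact h q hq s
  · intro h q hq s
    exact h _ ⟨q, hq, s, rfl⟩

lemma map_vanishP_add_map_vanishP {a b : ℕ} (V : Set (Pt K a)) (Z : Set (Pt K b)) :
    (vanishP K V).map (rename (Sum.inl : Fin (a + 1) → Fin (a + 1) ⊕ Fin (b + 1))) +
        (vanishP K Z).map (rename (Sum.inr : Fin (b + 1) → Fin (a + 1) ⊕ Fin (b + 1))) =
      vanishP2 K (V ×ˢ Z) := by
  ext F
  rw [vanishP_eq_vanishingIdeal V, mem_map_vanishingIdeal_add_map_iff]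
  simp only [vanishP, vanishP2, affineCone, Submodule.mem_iInf, RingHom.mem_ker, eval_evalLeft,
    Set.mem_ofPred_eq, Prod.forall, Set.mem_prod]
  constructor
  · intro h p q hpq s t
    exact h _ ⟨p, hpq.1, s, rfl⟩ q hpq.2 t
  · rintro h _ ⟨p, hp, s, rfl⟩ q hq t
    exact h p q ⟨hp, hq⟩ s t

/-- Over an infinite field, a polynomial vanishing on a line except possibly at one point vanishes
on the whole line. -/
lemma eval_sumElim_smul_eq_zero [Infinite K] {F : MvPolynomial (σ ⊕ τ) K} {u : σ → K} {v : τ → K}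
    (h : ∀ s : K, s ≠ 0 → eval (Sum.elim (s • u) v) F = 0) (s : K) :
    eval (Sum.elim (s • u) v) F = 0 := by
  let g : Polynomial K :=
    aeval (Sum.elim (fun i ↦ Polynomial.X * Polynomial.C (u i)) (fun j ↦ Polynomial.C (v j))) F
  have hg (r : K) : g.eval r = eval (Sum.elim (r • u) v) F := by
    have hhom : ((Polynomial.aeval r).comp (aeval (Sum.elim
        (fun i ↦ Polynomial.X * Polynomial.C (u i)) (fun j ↦ Polynomial.C (v j))))) =
        aeval (R := K) (Sum.elim (r • u) v) := by
      ext (i | j) <;> simp [mul_comm (u _)]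
    simpa [g] using DFunLike.congr_fun hhom F
  have hg0 : g = 0 := by
    refine Polynomial.eq_zero_of_infinite_isRoot g ((Set.finite_singleton 0).infinite_compl.mono ?_)
    intro r hr
    exact (hg r).trans (h r hr)
  rw [← hg, hg0, Polynomial.eval_zero]

lemma isSaturated_vanishP2 [Infinite K] {a b : ℕ} (X : Set (Pt K a × Pt K b)) :
    IsSaturated (vanishP2 K X) := by
  rintro f ⟨n, hn⟩
  simp only [vanishP2, Submodule.mem_iInf, RingHom.mem_ker] at hn ⊢
  intro p hp s t
  refine eval_sumElim_smul_eq_zero (fun r hr ↦ ?_) s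
  obtain ⟨i, hi⟩ := Function.ne_iff.1 p.1.rep_nonzero
  have h := hn _ (X_pow_mem_span_range_X_pow (Sum.inl i) n) p hp r t
  rw [map_mul, map_pow, eval_X] at h
  refine (mul_eq_zero.1 h).resolve_left (pow_ne_zero _ ?_)
  exact mul_ne_zero hr hi

end

/-- **Lemma (the identification).** Let `V₂ ⊆ V₁` be finite sets of points of `ℙ^{a₁}` and
`Z₁` a finite set of points of `ℙ^{a₂}`.  Working in the bigraded coordinate ring `R`, with
all vanishing ideals extended to `R`,
`(I_{V₁∖V₂} + I_{Z₁}) ∩ I_{V₂} = I_{V₁} + I_{V₂}·I_{Z₁}`;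
in particular `I_{V₁} + I_{V₂}·I_{Z₁}` is saturated with respect to the irrelevant maximal
ideal of `R`. -/
theorem identification [CharZero k] {a b : ℕ} (V₁ V₂ : Set (Pt k a)) (Z₁ : Set (Pt k b))
    (hV₁ : V₁.Finite) (hZ₁ : Z₁.Finite) (h21 : V₂ ⊆ V₁) :
    (Ideal.map (MvPolynomial.rename (Sum.inl : Fin (a + 1) → Fin (a + 1) ⊕ Fin (b + 1)))
        (vanishP k (V₁ \ V₂)) +
      Ideal.map (MvPolynomial.rename (Sum.inr : Fin (b + 1) → Fin (a + 1) ⊕ Fin (b + 1)))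
        (vanishP k Z₁)) ⊓
      Ideal.map (MvPolynomial.rename (Sum.inl : Fin (a + 1) → Fin (a + 1) ⊕ Fin (b + 1)))
        (vanishP k V₂) =
      Ideal.map (MvPolynomial.rename (Sum.inl : Fin (a + 1) → Fin (a + 1) ⊕ Fin (b + 1)))
        (vanishP k V₁) +
      Ideal.map (MvPolynomial.rename (Sum.inl : Fin (a + 1) → Fin (a + 1) ⊕ Fin (b + 1)))
          (vanishP k V₂) *
        Ideal.map (MvPolynomial.rename (Sum.inr : Fin (b + 1) → Fin (a + 1) ⊕ Fin (b + 1)))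
          (vanishP k Z₁) ∧
    IsSaturated
      (Ideal.map (MvPolynomial.rename (Sum.inl : Fin (a + 1) → Fin (a + 1) ⊕ Fin (b + 1)))
          (vanishP k V₁) +
        Ideal.map (MvPolynomial.rename (Sum.inl : Fin (a + 1) → Fin (a + 1) ⊕ Fin (b + 1)))
            (vanishP k V₂) *
          Ideal.map (MvPolynomial.rename (Sum.inr : Fin (b + 1) → Fin (a + 1) ⊕ Fin (b + 1)))
            (vanishP k Z₁)) := by
  have : Infinite k := CharZero.infinite k
  have heq := MvPolynomial.map_vanishingIdeal_add_map_inf (affineCone (V₁ \ V₂)) (affineCone V₂)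
    (vanishP k Z₁)
  rw [← affineCone_union, Set.sdiff_union_of_subset h21] at heq
  simp only [← vanishP_eq_vanishingIdeal] at heq
  refine ⟨heq, ?_⟩
  rw [← heq, map_vanishP_add_map_vanishP, vanishP_eq_vanishingIdeal]
  exact (isSaturated_vanishP2 _).inf (isSaturated_map_vanishingIdeal _)

end
end
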